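/- Let p, r : [0,1] → ℝ be continuous with p(x) > 0 and r(x) > 0 for all x ∈ [0,1], and let c ∈ ℝ. Let N₄ be the set of λ < 0 that are eigenvalues of the problem (E_T) with boundary conditions (BC1), and let N₂ be the set of λ < 0 for which there exists a nontrivial u ∈ C²([0,1],ℝ) with −u''(x) + c·r(x)·u(x) = λ·u(x) for all x ∈ [0,1] and u(0) = u(1) = 0. Then both N₄ and N₂ are finite sets and they have the same number of elements. -/

import Mathlib

open Set

/-- Derivative within the interval `[0,1]`. -/
noncomputable def Dv (y : ℝ → ℝ) : ℝ → ℝ := derivWithin y (Set.Icc 0 1)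

/-- `y` is not identically zero on `[0,1]`. -/
def Nontriv (y : ℝ → ℝ) : Prop := ∃ x ∈ Set.Icc (0:ℝ) 1, y x ≠ 0

/-- `y` is a classical solution of `(p y'')'' - lam * (-y'' + c r y) = 0` on `[0,1]`. -/
def SolT (p r : ℝ → ℝ) (c lam : ℝ) (y : ℝ → ℝ) : Prop :=
  ContDiffOn ℝ 2 y (Set.Icc 0 1) ∧
  ContDiffOn ℝ 2 (fun x => p x * Dv (Dv y) x) (Set.Icc 0 1) ∧
  ∀ x ∈ Set.Icc (0:ℝ) 1,
    Dv (Dv (fun t => p t * Dv (Dv y) t)) x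
      - lam * (-(Dv (Dv y) x) + c * r x * y x) = 0

/-- Clamped boundary conditions `y(0) = y'(0) = y(1) = y'(1) = 0`. -/
def BC1 (y : ℝ → ℝ) : Prop := y 0 = 0 ∧ Dv y 0 = 0 ∧ y 1 = 0 ∧ Dv y 1 = 0

/-- Boundary conditions `y(0) = y'(0) = y'(1) = 0`, `(p y'')'(1) + lam * alpha * y(1) = 0`. -/
def BC2 (p : ℝ → ℝ) (lam alpha : ℝ) (y : ℝ → ℝ) : Prop :=
  y 0 = 0 ∧ Dv y 0 = 0 ∧ Dv y 1 = 0 ∧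
  Dv (fun t => p t * Dv (Dv y) t) 1 + lam * alpha * y 1 = 0

/-- Linear dependence of two functions on `[0,1]`. -/
def LinDep (y₁ y₂ : ℝ → ℝ) : Prop :=
  ∃ a b : ℝ, (a ≠ 0 ∨ b ≠ 0) ∧ ∀ x ∈ Set.Icc (0:ℝ) 1, a * y₁ x + b * y₂ x = 0

/-- `lam` is an eigenvalue of the problem (E_T), (BC1). -/
def EigT1 (p r : ℝ → ℝ) (c lam : ℝ) : Prop :=
  ∃ y : ℝ → ℝ, SolT p r c lam y ∧ Nontriv y ∧ BC1 y

open scoped RealInnerProductSpace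

section Abstract
variable {H : Type*} [NormedAddCommGroup H] [InnerProductSpace ℝ H] [CompleteSpace H]

/-- Quadratic form on a linear combination of `A`-orthogonal vectors. -/
lemma quad_sum {ι : Type*} (s : Finset ι) (A : H →L[ℝ] H) (u : ι → H)
    (hu : ∀ i ∈ s, ∀ j ∈ s, i ≠ j → ⟪A (u i), u j⟫ = 0) :
    ⟪A (∑ i ∈ s, u i), ∑ i ∈ s, u i⟫ = ∑ i ∈ s, ⟪A (u i), u i⟫ := by
  rw [map_sum, sum_inner]
  refine Finset.sum_congr rfl fun i hi => ?_
  rw [inner_sum, Finset.sum_eq_single_of_mem i hi]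
  intro j hj hij
  exact hu i hi j hj hij.symm

lemma spec_le (T : H →L[ℝ] H) (hT : IsCompactOperator T) (hs : ∀ x y, ⟪T x, y⟫ = ⟪x, T y⟫)
    (t : ℝ) (x : H) (hx : ∀ μ > t, ∀ e, T e = μ • e → ⟪e, x⟫ = 0) :
    ⟪T x, x⟫ ≤ t * ‖x‖ ^ 2 := by
  have hsym : (T : H →ₗ[ℝ] H).IsSymmetric := fun x y => hs x y
  have hortho : ∀ μ ν : ℝ, μ ≠ ν → ∀ e f : H, T e = μ • e → T f = ν • f → ⟪e, f⟫ = 0 := by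
    intro μ ν hne e f he hf
    have h := hs e f
    rw [he, hf, inner_smul_left, inner_smul_right] at h
    have : (μ - ν) * ⟪e, f⟫ = 0 := by simp only [conj_trivial] at h; linarith
    rcases mul_eq_zero.1 this with h | h
    · exact absurd (sub_eq_zero.1 h) hne
    · exact h
  have hbot := ContinuousLinearMap.orthogonalComplement_iSup_eigenspaces_eq_bot hT hsym
  set D : Submodule ℝ H := ⨆ μ : {μ : ℝ // μ ≤ t}, Module.End.eigenspace (T : Module.End ℝ H) μ with hD
  set U : Submodule ℝ H := ⨆ μ : {μ : ℝ // t < μ}, Module.End.eigenspace (T : Module.End ℝ H) μ with hU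
  have hxU : x ∈ Uᗮ := by
    rw [hU, ← Submodule.iInf_orthogonal] 
    rw [Submodule.mem_iInf]
    rintro ⟨μ, hμ⟩
    rw [Submodule.mem_orthogonal]
    intro e he
    rw [Module.End.mem_eigenspace_iff] at he
    exact hx μ hμ e he
  have hUD : U ≤ Dᗮ := by
    refine iSup_le ?_
    rintro ⟨μ, hμ⟩ e he
    rw [hD, ← Submodule.iInf_orthogonal, Submodule.mem_iInf]
    rintro ⟨ν, hν⟩
    rw [Submodule.mem_orthogonal]
    intro f hf
    rw [Module.End.mem_eigenspace_iff] at he hf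
    exact hortho ν μ (by rintro rfl; linarith) f e hf he
  have hDU : Dᗮ ⊓ Uᗮ = ⊥ := by
    rw [Submodule.inf_orthogonal, eq_bot_iff, ← hbot]
    apply Submodule.orthogonal_le
    refine iSup_le fun μ => ?_
    rcases le_or_gt μ t with h | h
    · exact le_trans (le_iSup (fun μ : {μ : ℝ // μ ≤ t} => Module.End.eigenspace (T : Module.End ℝ H) μ) ⟨μ, h⟩) le_sup_left
    · exact le_trans (le_iSup (fun μ : {μ : ℝ // t < μ} => Module.End.eigenspace (T : Module.End ℝ H) μ) ⟨μ, h⟩) le_sup_right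
  have hxD : x ∈ D.topologicalClosure := by
    rw [← Submodule.orthogonal_orthogonal_eq_closure, Submodule.mem_orthogonal]
    intro y hy
    have hUc : U.topologicalClosure ≤ Dᗮ :=
      Submodule.topologicalClosure_minimal _ hUD (Submodule.isClosed_orthogonal _)
    have : CompleteSpace U.topologicalClosure :=
      U.isClosed_topologicalClosure.completeSpace_coe
    obtain ⟨a, ha, b, hb, hab⟩ := Submodule.exists_add_mem_mem_orthogonal (K := U.topologicalClosure) y
    have hb0 : b = 0 := by
      have : b ∈ Dᗮ ⊓ Uᗮ := by
        refine ⟨?_, ?_⟩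
        · have : b = y - a := by rw [hab]; abel
          rw [this]; exact Submodule.sub_mem _ hy (hUc ha)
        · exact Submodule.orthogonal_le U.le_topologicalClosure hb
      rwa [hDU, Submodule.mem_bot] at this
    rw [hab, hb0, add_zero]
    have hxUc : x ∈ U.topologicalClosureᗮ := by
      rw [Submodule.orthogonal_closure]; exact hxU
    exact Submodule.inner_right_of_mem_orthogonal ha hxUc
  have hcl : IsClosed {x : H | ⟪T x, x⟫ ≤ t * ‖x‖ ^ 2} :=
    isClosed_le (by fun_prop) (by fun_prop)
  have hDs : (D : Set H) ⊆ {x : H | ⟪T x, x⟫ ≤ t * ‖x‖ ^ 2} := by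
    intro z hz
    rw [hD] at hz
    obtain ⟨f, hf, rfl⟩ := (Submodule.mem_iSup_iff_exists_finsupp _ _).1 hz
    simp only [Module.End.mem_eigenspace_iff] at hf
    have h0 : ∀ i j, i ≠ j → ⟪f i, f j⟫ = 0 := fun i j hij =>
      hortho i j (fun h => hij (Subtype.ext h)) _ _ (hf i) (hf j)
    show ⟪T (∑ i ∈ f.support, f i), ∑ i ∈ f.support, f i⟫ ≤ t * ‖∑ i ∈ f.support, f i‖ ^ 2
    rw [quad_sum, ← real_inner_self_eq_norm_sq]
    · have h1 := quad_sum f.support (ContinuousLinearMap.id ℝ H) f (fun i _ j _ hij => h0 i j hij)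
      simp only [ContinuousLinearMap.id_apply] at h1
      rw [h1, Finset.mul_sum]
      refine Finset.sum_le_sum fun i _ => ?_
      have := hf i
      simp only [ContinuousLinearMap.coe_coe] at this
      rw [this, inner_smul_left]
      exact mul_le_mul_of_nonneg_right i.2 real_inner_self_nonneg
    · intro i _ j _ hij
      have := hf i
      simp only [ContinuousLinearMap.coe_coe] at this
      rw [this, inner_smul_left, h0 i j hij, mul_zero]
  exact closure_minimal hDs hcl hxD

/-- A negative vector in the span killed by few functionals. -/
lemma exists_neg {ι κ : Type*} [Fintype ι] [Fintype κ] (hcard : Fintype.card κ < Fintype.card ι)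
    (A : H →L[ℝ] H) (u : ι → H)
    (hu : ∀ i j, i ≠ j → ⟪A (u i), u j⟫ = 0) (hn : ∀ i, ⟪A (u i), u i⟫ < 0)
    (l : κ → H) : ∃ x ∈ Submodule.span ℝ (range u), ⟪A x, x⟫ < 0 ∧ ∀ k, ⟪l k, x⟫ = 0 := by
  let F : (ι → ℝ) →ₗ[ℝ] (κ → ℝ) :=
    { toFun := fun a k => ⟪l k, ∑ i, a i • u i⟫
      map_add' := by
        intro a b; ext k; simp [add_smul, Finset.sum_add_distrib, inner_add_right]
      map_smul' := by
        intro m a; ext k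
        simp only [Pi.smul_apply, smul_eq_mul, mul_smul, ← Finset.smul_sum, inner_smul_right,
          RingHom.id_apply] }
  have hF : LinearMap.ker F ≠ ⊥ := F.ker_ne_bot_of_finrank_lt (by simpa using hcard)
  obtain ⟨a, ha, ha0⟩ := (Submodule.ne_bot_iff _).mp hF
  refine ⟨∑ i, a i • u i, ?_, ?_, ?_⟩
  · exact Submodule.sum_mem _ fun i _ => Submodule.smul_mem _ _ (Submodule.subset_span ⟨i, rfl⟩)
  · rw [quad_sum]
    · obtain ⟨i, hi⟩ := Function.ne_iff.1 ha0
      refine Finset.sum_neg' ?_ ⟨i, Finset.mem_univ _, ?_⟩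
      · intro j _
        rw [map_smul, inner_smul_left, inner_smul_right]
        simp only [conj_trivial]
        nlinarith [hn j, mul_self_nonneg (a j)]
      · rw [map_smul, inner_smul_left, inner_smul_right]
        simp only [conj_trivial]
        have : 0 < a i * a i := mul_self_pos.2 hi
        nlinarith [hn i]
    · intro i _ j _ hij
      rw [map_smul, inner_smul_left, inner_smul_right, hu i j hij]; simp
  · intro k
    exact congrFun ha k

/-- Compact symmetric operators have finitely many eigenvalues away from zero. -/
lemma finite_eig (T : H →L[ℝ] H) (hT : IsCompactOperator T) (hs : ∀ x y, ⟪T x, y⟫ = ⟪x, T y⟫)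
    (t : ℝ) (ht : 0 < t) : {μ : ℝ | t < μ ∧ ∃ e, e ≠ 0 ∧ T e = μ • e}.Finite := by
  by_contra hinf
  have hinf : {μ : ℝ | t < μ ∧ ∃ e, e ≠ 0 ∧ T e = μ • e}.Infinite := hinf
  let em := hinf.natEmbedding
  have h1 : ∀ n, ∃ e : H, ‖e‖ = 1 ∧ T e = (em n : ℝ) • e := by
    intro n
    obtain ⟨e, he, hTe⟩ := (em n).2.2
    refine ⟨(‖e‖⁻¹ : ℝ) • e, ?_, ?_⟩
    · rw [norm_smul, norm_inv, norm_norm, inv_mul_cancel₀ (norm_ne_zero_iff.2 he)]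
    · rw [map_smul, hTe, smul_comm]
  choose e he hTe using h1
  have hpos : ∀ n, t < (em n : ℝ) := fun n => (em n).2.1
  have horth : ∀ n m, n ≠ m → ⟪e n, e m⟫ = 0 := by
    intro n m hnm
    have h := hs (e n) (e m)
    rw [hTe, hTe, inner_smul_left, inner_smul_right] at h
    have : ((em n : ℝ) - em m) * ⟪e n, e m⟫ = 0 := by simp only [conj_trivial] at h; linarith
    rcases mul_eq_zero.1 this with h | h
    · exact absurd (em.injective (Subtype.ext (sub_eq_zero.1 h))) hnm
    · exact h
  have hK := hT.isCompact_closure_image_closedBall 1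
  obtain ⟨a, -, φ, hφ, hlim⟩ := hK.tendsto_subseq (x := fun n => T (e n))
    (fun n => subset_closure ⟨e n, by simp [he], rfl⟩)
  have hc := hlim.cauchySeq
  rw [Metric.cauchySeq_iff] at hc
  obtain ⟨N, hN⟩ := hc t ht
  have h2 := hN N le_rfl (N+1) (by omega)
  simp only [Function.comp] at h2
  have hne : φ N ≠ φ (N+1) := fun h => by have := hφ.injective h; omega
  rw [dist_eq_norm, hTe, hTe] at h2
  have h3 : ‖(em (φ N) : ℝ) • e (φ N) - (em (φ (N+1)) : ℝ) • e (φ (N+1))‖ ^ 2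
      = (em (φ N) : ℝ) ^ 2 + (em (φ (N+1)) : ℝ) ^ 2 := by
    rw [norm_sub_sq_real, inner_smul_left, inner_smul_right, horth _ _ hne, norm_smul, norm_smul,
      he, he]
    simp
  have h4 : ‖(em (φ N) : ℝ) • e (φ N) - (em (φ (N+1)) : ℝ) • e (φ (N+1))‖ ^ 2 < t ^ 2 :=
    pow_lt_pow_left₀ h2 (norm_nonneg _) (by norm_num)
  rw [h3] at h4
  nlinarith [hpos (φ N), sq_nonneg (em (φ (N+1)) : ℝ)]

end Abstract


section Abstract2
variable {H : Type*} [NormedAddCommGroup H] [InnerProductSpace ℝ H] [CompleteSpace H]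

lemma count4 (A W W' : H →L[ℝ] H) (hAs : ∀ x y, ⟪A x, y⟫ = ⟪x, A y⟫)
    (hW : ∀ x y, ⟪W x, y⟫ = ⟪x, W' y⟫) (hWc : IsCompactOperator W)
    (N4 : Set ℝ) (hN4 : N4.Finite) (hneg : ∀ l ∈ N4, l < 0)
    (h4a : ∀ l ∈ N4, ∃ v, v ≠ 0 ∧ l • W' (A (W v)) = v)
    (h4b : ∀ l : ℝ, l < 0 → ∀ v, v ≠ 0 → l • W' (A (W v)) = v → l ∈ N4)
    (h4s : ∀ l : ℝ, l < 0 → ∀ v v', v ≠ 0 → l • W' (A (W v)) = v → l • W' (A (W v')) = v' →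
      ∃ k : ℝ, v' = k • v)
    {ι : Type*} [Fintype ι] (u : ι → H) (huW : ∀ i, u i ∈ closure (range W))
    (hu : ∀ i j, i ≠ j → ⟪A (u i), u j⟫ = 0) (hn : ∀ i, ⟪A (u i), u i⟫ < 0) :
    Fintype.card ι ≤ N4.ncard := by
  by_contra hlt
  push Not at hlt
  have : Fintype N4 := hN4.fintype
  have hcard : Fintype.card N4 < Fintype.card ι := by
    rwa [← Nat.card_eq_fintype_card, Nat.card_coe_set_eq]
  have hW2 : ∀ x y, ⟪W' x, y⟫ = ⟪x, W y⟫ := fun x y => by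
    rw [real_inner_comm, ← hW, real_inner_comm]
  choose v hv0 hv using fun l : N4 => h4a l l.2
  have hinn : ∀ (l : N4) w, ⟪v l, w⟫ = l * ⟪A (W (v l)), W w⟫ := by
    intro l w
    conv_lhs => rw [← hv l]
    rw [inner_smul_left, hW2]; simp
  have horth : ∀ l m : N4, l ≠ m → ⟪v l, v m⟫ = 0 := by
    intro l m hlm
    have h1 := hinn l (v m)
    have h2 := hinn m (v l)
    rw [real_inner_comm, hAs, real_inner_comm (A (W (v l)))] at h2
    have hl := hneg l l.2
    have hm := hneg m m.2
    rw [h1] at h2 ⊢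
    have h3 : ((l:ℝ) - m) * ⟪A (W (v l)), W (v m)⟫ = 0 := by linarith
    rcases mul_eq_zero.1 h3 with h | h
    · exact absurd (Subtype.ext (sub_eq_zero.1 h)) hlm
    · rw [h, mul_zero]
  obtain ⟨x, hxs, hxn, hx0⟩ := exists_neg hcard A u hu hn (fun l : N4 => A (W (v l)))
  have hxc : x ∈ closure (range W) := by
    have h1 : Submodule.span ℝ (range u) ≤ (LinearMap.range (W : H →ₗ[ℝ] H)).topologicalClosure := by
      rw [Submodule.span_le]
      rintro _ ⟨i, rfl⟩
      have := huW i
      rw [SetLike.mem_coe, ← SetLike.mem_coe, Submodule.topologicalClosure_coe]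
      exact this
    have := h1 hxs
    rw [← SetLike.mem_coe, Submodule.topologicalClosure_coe] at this
    exact this
  -- the projected map
  let Φ : H → H := fun z => z - ∑ l : N4, (l * ⟪A (W (v l)), z⟫ / ‖v l‖ ^ 2) • W (v l)
  have hΦ : Continuous Φ := by
    simp only [Φ]
    fun_prop
  have hcl : IsClosed {z : H | 0 ≤ ⟪A (Φ z), Φ z⟫} :=
    isClosed_le continuous_const (by fun_prop)
  have hsub : range W ⊆ {z : H | 0 ≤ ⟪A (Φ z), Φ z⟫} := by
    rintro _ ⟨w, rfl⟩
    set w' : H := w - ∑ l : N4, (⟪v l, w⟫ / ‖v l‖ ^ 2) • v l with hw'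
    have hWw : Φ (W w) = W w' := by
      simp only [Φ, hw', map_sub, map_sum, map_smul, hinn]
    show 0 ≤ ⟪A (Φ (W w)), Φ (W w)⟫
    rw [hWw]
    have horth' : ∀ l : N4, ⟪v l, w'⟫ = 0 := by
      intro l
      rw [hw', inner_sub_right, inner_sum, Finset.sum_eq_single_of_mem l (Finset.mem_univ _)]
      · rw [inner_smul_right, real_inner_self_eq_norm_sq, div_mul_cancel₀, sub_self]
        exact pow_ne_zero _ (norm_ne_zero_iff.2 (hv0 l))
      · intro m _ hm
        rw [inner_smul_right, horth l m hm.symm, mul_zero]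
    let K : H →L[ℝ] H := -(W' ∘L A ∘L W)
    have hKx : ∀ x, K x = - W' (A (W x)) := fun x => rfl
    have hKc : IsCompactOperator K := by
      have := (hWc.clm_comp (W' ∘L A)).neg
      exact this
    have hKs : ∀ x y, ⟪K x, y⟫ = ⟪x, K y⟫ := by
      intro x y
      rw [hKx, hKx, inner_neg_left, inner_neg_right, hW2, hAs, hW]
    have := spec_le K hKc hKs 0 w' ?_
    · rw [hKx, inner_neg_left, hW2] at this
      linarith
    · intro μ hμ e he
      by_cases he0 : e = 0
      · simp [he0]
      rw [hKx] at he
      have hl : -μ⁻¹ < 0 := by simpa using hμ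
      have he2 : (-μ⁻¹) • W' (A (W e)) = e := by
        rw [neg_smul, ← smul_neg, he, smul_smul, inv_mul_cancel₀ (ne_of_gt hμ), one_smul]
      have hmem := h4b _ hl e he0 he2
      obtain ⟨k, hk⟩ := h4s (-μ⁻¹) hl (v ⟨_, hmem⟩) e (hv0 ⟨_, hmem⟩) (hv ⟨_, hmem⟩) he2
      rw [hk, inner_smul_left, horth', mul_zero]
  have hfin := closure_minimal hsub hcl hxc
  have hΦx : Φ x = x := by simp [Φ, hx0]
  have : 0 ≤ ⟪A (Φ x), Φ x⟫ := hfin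
  rw [hΦx] at this
  linarith

lemma count2 (A J J' R : H →L[ℝ] H)
    (hJ : ∀ x y, ⟪J x, y⟫ = ⟪x, J' y⟫) (hJc : IsCompactOperator J)
    (hR : ∀ x y, ⟪R x, y⟫ = ⟪x, R y⟫)
    (hA : ∀ x, A x = x + J' (R (J x))) (M : ℝ) (hM0 : 0 < M)
    (hM : ∀ x, 0 ≤ ⟪R x, x⟫ + M * ‖x‖ ^ 2)
    (N2 : Set ℝ) (hneg : ∀ l ∈ N2, l < 0)
    (h2a : ∀ l ∈ N2, ∃ v, v ≠ 0 ∧ A v = l • J' (J v))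
    (h2b : ∀ l : ℝ, l < 0 → ∀ v, v ≠ 0 → A v = l • J' (J v) → l ∈ N2)
    (h2s : ∀ l : ℝ, l < 0 → ∀ v v', v ≠ 0 → A v = l • J' (J v) → A v' = l • J' (J v') →
      ∃ k : ℝ, v' = k • v) :
    N2.Finite ∧ ∀ {ι : Type} [Fintype ι] (u : ι → H)
    (_ : ∀ i j, i ≠ j → ⟪A (u i), u j⟫ = 0) (_ : ∀ i, ⟪A (u i), u i⟫ < 0),
    Fintype.card ι ≤ N2.ncard := by
  have hJ2 : ∀ x y, ⟪J' x, y⟫ = ⟪x, J y⟫ := fun x y => by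
    rw [real_inner_comm, ← hJ, real_inner_comm]
  let G : H →L[ℝ] H := A + M • (J' ∘L J)
  have hG : ∀ x, G x = A x + M • J' (J x) := fun x => rfl
  have hGpos : ∀ x, ‖x‖ ^ 2 ≤ ⟪G x, x⟫ := by
    intro x
    rw [hG, hA, inner_add_left, inner_add_left, inner_smul_left, hJ2, hJ2,
      real_inner_self_eq_norm_sq, real_inner_self_eq_norm_sq]
    have := hM (J x)
    simp only [conj_trivial]
    linarith
  have hGs : ∀ x y, ⟪G x, y⟫ = ⟪x, G y⟫ := by
    intro x y
    rw [hG, hA, hG, hA, inner_add_left, inner_add_left, inner_smul_left, hJ2, hJ2,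
      inner_add_right, inner_add_right, inner_smul_right, ← hJ, ← hJ, hR]
    simp
  have hu : IsUnit G := by
    refine ContinuousLinearMap.isUnit_of_forall_le_norm_inner_map G (c := 1) one_pos ?_
    intro x
    have := hGpos x
    simpa using this.trans (le_abs_self _)
  obtain ⟨Gu, hGu⟩ := hu
  let Gi : H →L[ℝ] H := ((Gu⁻¹ : (H →L[ℝ] H)ˣ) : H →L[ℝ] H)
  have hGi1 : ∀ x, G (Gi x) = x := by
    intro x
    have : (Gu : H →L[ℝ] H) * Gi = 1 := Gu.mul_inv
    rw [hGu] at this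
    exact DFunLike.congr_fun this x
  have hGi2 : ∀ x, Gi (G x) = x := by
    intro x
    have : Gi * (Gu : H →L[ℝ] H) = 1 := Gu.inv_mul
    rw [hGu] at this
    exact DFunLike.congr_fun this x
  have hGis : ∀ x y, ⟪Gi x, y⟫ = ⟪x, Gi y⟫ := by
    intro x y
    conv_lhs => rw [← hGi1 y, ← hGs, hGi1]
  let T : H →L[ℝ] H := J ∘L Gi ∘L J'
  have hT : ∀ x, T x = J (Gi (J' x)) := fun x => rfl
  have hTc : IsCompactOperator T := hJc.comp_clm (Gi ∘L J')
  have hTs : ∀ x y, ⟪T x, y⟫ = ⟪x, T y⟫ := by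
    intro x y
    rw [hT, hT, hJ, hGis, hJ2]
  have hTe : ∀ μ : ℝ, 1 / M < μ → ∀ e, e ≠ 0 → T e = μ • e →
      (μ⁻¹ - M) < 0 ∧ Gi (J' e) ≠ 0 ∧ A (Gi (J' e)) = (μ⁻¹ - M) • J' (J (Gi (J' e))) := by
    intro μ hμ e he0 he
    have hμ0 : 0 < μ := lt_trans (by positivity) hμ
    rw [hT] at he
    refine ⟨?_, ?_, ?_⟩
    · rw [sub_neg, inv_lt_comm₀ hμ0 hM0]; simpa using hμ
    · intro h0
      rw [h0, map_zero] at he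
      exact smul_ne_zero hμ0.ne' he0 he.symm
    · have h1 := hG (Gi (J' e))
      rw [hGi1] at h1
      rw [sub_smul, eq_sub_iff_add_eq, ← h1, he, map_smul, smul_smul, inv_mul_cancel₀ hμ0.ne',
        one_smul]
  have hfin : N2.Finite := by
    refine ((finite_eig T hTc hTs (1 / M) (by positivity)).image (fun μ => μ⁻¹ - M)).subset ?_
    intro l hl
    obtain ⟨v, hv0, hv⟩ := h2a l hl
    have hGv : G v = (l + M) • J' (J v) := by rw [hG, hv, add_smul]
    have hl0 := hneg l hl
    have hlM : 0 < l + M := by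
      have h1 := hGpos v
      rw [hGv, inner_smul_left, hJ2, real_inner_self_eq_norm_sq] at h1
      have h2 : 0 < ‖v‖ ^ 2 := by positivity
      simp only [conj_trivial] at h1
      by_contra h3
      nlinarith [sq_nonneg ‖J v‖]
    refine ⟨(l + M)⁻¹, ⟨?_, J v, ?_, ?_⟩, by simp⟩
    · rw [one_div]; exact inv_strictAnti₀ hlM (by linarith)
    · intro h0
      rw [h0, map_zero, smul_zero] at hGv
      have := hGi2 v
      rw [hGv, map_zero] at this
      exact hv0 this.symm
    · rw [hT]
      have : J' (J v) = (l + M)⁻¹ • G v := by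
        rw [hGv, smul_smul, inv_mul_cancel₀ hlM.ne', one_smul]
      rw [this, map_smul, hGi2, map_smul]
  refine ⟨hfin, ?_⟩
  intro ι _ u hu hn
  by_contra hlt
  push Not at hlt
  have : Fintype N2 := hfin.fintype
  have hcard : Fintype.card N2 < Fintype.card ι := by
    rwa [← Nat.card_eq_fintype_card, Nat.card_coe_set_eq]
  choose v hv0 hv using fun l : N2 => h2a l l.2
  obtain ⟨x, -, hxn, hx0⟩ := exists_neg hcard A u hu hn (fun l : N2 => J' (J (v l)))
  have h1 := spec_le T hTc hTs (1 / M) (J x) ?_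
  · set g := Gi (J' (J x)) with hg
    have h2 := hGpos (x - M • g)
    have hGg : G g = J' (J x) := hGi1 _
    have h3 : ⟪T (J x), J x⟫ = ⟪g, J' (J x)⟫ := by rw [hT, hJ]
    have h4 : ⟪G x, x⟫ = ⟪A x, x⟫ + M * ‖J x‖ ^ 2 := by
      rw [hG, inner_add_left, inner_smul_left, hJ2, real_inner_self_eq_norm_sq]; simp
    have h5 : ⟪G x, g⟫ = ‖J x‖ ^ 2 := by
      rw [hGs, hGg, ← hJ, real_inner_self_eq_norm_sq]
    have h6 : ⟪J' (J x), x⟫ = ‖J x‖ ^ 2 := by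
      rw [hJ2, real_inner_self_eq_norm_sq]
    rw [map_sub, map_smul, hGg, inner_sub_left, inner_sub_right, inner_sub_right,
      inner_smul_left, inner_smul_left, inner_smul_right, inner_smul_right, h4, h5, h6,
      real_inner_comm g, ← h3] at h2
    simp only [conj_trivial] at h2
    have h7 : M * (M * ⟪T (J x), J x⟫) ≤ M * ‖J x‖ ^ 2 := by
      have := mul_le_mul_of_nonneg_left h1 (mul_pos hM0 hM0).le
      have h8 : M * M * (1 / M * ‖J x‖ ^ 2) = M * ‖J x‖ ^ 2 := by field_simp
      linarith
    nlinarith [sq_nonneg ‖x - M • g‖]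
  · intro μ hμ e he
    by_cases he0 : e = 0
    · simp [he0]
    obtain ⟨hl, hg0, hgA⟩ := hTe μ hμ e he0 he
    have hmem := h2b _ hl _ hg0 hgA
    obtain ⟨k, hk⟩ := h2s (μ⁻¹ - M) hl (v ⟨_, hmem⟩) (Gi (J' e)) (hv0 ⟨_, hmem⟩) (hv ⟨_, hmem⟩) hgA
    have hμ0 : 0 < μ := lt_trans (by positivity) hμ
    have : e = μ⁻¹ • T e := by rw [he, smul_smul, inv_mul_cancel₀ hμ0.ne', one_smul]
    rw [this, hT, hk, map_smul, inner_smul_left, inner_smul_left, ← hJ2, hx0]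
    simp

theorem abs_main (A J J' R W W' : H →L[ℝ] H)
    (hJ : ∀ x y, ⟪J x, y⟫ = ⟪x, J' y⟫) (hJc : IsCompactOperator J)
    (hW : ∀ x y, ⟪W x, y⟫ = ⟪x, W' y⟫) (hWc : IsCompactOperator W)
    (hR : ∀ x y, ⟪R x, y⟫ = ⟪x, R y⟫)
    (hA : ∀ x, A x = x + J' (R (J x))) (M : ℝ) (hM0 : 0 < M)
    (hM : ∀ x, 0 ≤ ⟪R x, x⟫ + M * ‖x‖ ^ 2)
    (N2 N4 : Set ℝ) (hneg2 : ∀ l ∈ N2, l < 0) (hneg4 : ∀ l ∈ N4, l < 0)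
    (h2a : ∀ l ∈ N2, ∃ v, v ≠ 0 ∧ v ∈ closure (range W) ∧ A v = l • J' (J v))
    (h2b : ∀ l : ℝ, l < 0 → ∀ v, v ≠ 0 → A v = l • J' (J v) → l ∈ N2)
    (h2s : ∀ l : ℝ, l < 0 → ∀ v v', v ≠ 0 → A v = l • J' (J v) → A v' = l • J' (J v') →
      ∃ k : ℝ, v' = k • v)
    (h4a : ∀ l ∈ N4, ∃ v, v ≠ 0 ∧ l • W' (A (W v)) = v)
    (h4b : ∀ l : ℝ, l < 0 → ∀ v, v ≠ 0 → l • W' (A (W v)) = v → l ∈ N4)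
    (h4s : ∀ l : ℝ, l < 0 → ∀ v v', v ≠ 0 → l • W' (A (W v)) = v → l • W' (A (W v')) = v' →
      ∃ k : ℝ, v' = k • v) :
    N4.Finite ∧ N2.Finite ∧ N4.ncard = N2.ncard := by
  have hJ2 : ∀ x y, ⟪J' x, y⟫ = ⟪x, J y⟫ := fun x y => by
    rw [real_inner_comm, ← hJ, real_inner_comm]
  have hW2 : ∀ x y, ⟪W' x, y⟫ = ⟪x, W y⟫ := fun x y => by
    rw [real_inner_comm, ← hW, real_inner_comm]
  have hAs : ∀ x y, ⟪A x, y⟫ = ⟪x, A y⟫ := by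
    intro x y
    rw [hA, hA, inner_add_left, inner_add_right, hJ2, hR, hJ]
  obtain ⟨hfin2, hc2⟩ := count2 A J J' R hJ hJc hR hA M hM0 hM N2 hneg2
    (fun l hl => by obtain ⟨v, h1, -, h2⟩ := h2a l hl; exact ⟨v, h1, h2⟩) h2b h2s
  -- every finite part of N4
  have h4le : ∀ S : Finset ℝ, (S : Set ℝ) ⊆ N4 → S.card ≤ N2.ncard := by
    intro S hS
    choose v hv0 hv using fun l : S => h4a l (hS l.2)
    have hinn : ∀ (l : S) w, ⟪v l, w⟫ = l * ⟪A (W (v l)), W w⟫ := by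
      intro l w
      conv_lhs => rw [← hv l]
      rw [inner_smul_left, hW2]; simp
    have := hc2 (fun l : S => W (v l)) ?_ ?_
    · simpa using this
    · intro l m hlm
      have h1 := hinn l (v m)
      have h2 := hinn m (v l)
      rw [real_inner_comm, hAs, real_inner_comm (A (W (v l)))] at h2
      rw [h1] at h2
      have h3 : ((l:ℝ) - m) * ⟪A (W (v l)), W (v m)⟫ = 0 := by linarith
      rcases mul_eq_zero.1 h3 with h | h
      · exact absurd (Subtype.ext (sub_eq_zero.1 h)) hlm
      · exact h
    · intro l
      have h1 := hinn l (v l)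
      rw [real_inner_self_eq_norm_sq] at h1
      have h2 : 0 < ‖v l‖ ^ 2 := by have := hv0 l; positivity
      have h3 := hneg4 l (hS l.2)
      by_contra h4
      nlinarith
  have hfin4 : N4.Finite := by
    by_contra hinf
    obtain ⟨S, hS, hcard⟩ := Set.Infinite.exists_subset_card_eq hinf (N2.ncard + 1)
    have := h4le S hS
    omega
  refine ⟨hfin4, hfin2, le_antisymm ?_ ?_⟩
  · have := h4le hfin4.toFinset (by simp)
    rwa [← Set.ncard_eq_toFinset_card _ hfin4] at this
  · have : Fintype N2 := hfin2.fintype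
    choose v hv0 hvW hv using fun l : N2 => h2a l l.2
    have hinn : ∀ (l : N2) w, ⟪A (v l), w⟫ = l * ⟪J (v l), J w⟫ := by
      intro l w
      rw [hv, inner_smul_left, hJ2]; simp
    have := count4 A W W' hAs hW hWc N4 hfin4 hneg4 h4a h4b h4s v hvW ?_ ?_
    · rwa [← Nat.card_eq_fintype_card, Nat.card_coe_set_eq] at this
    · intro l m hlm
      have h1 := hinn l (v m)
      have h2 := hinn m (v l)
      rw [hAs, real_inner_comm, real_inner_comm (J (v l))] at h2
      rw [h1] at h2 ⊢
      have h3 : ((l:ℝ) - m) * ⟪J (v l), J (v m)⟫ = 0 := by linarith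
      rcases mul_eq_zero.1 h3 with h | h
      · exact absurd (Subtype.ext (sub_eq_zero.1 h)) hlm
      · rw [h, mul_zero]
    · intro l
      rw [hinn, real_inner_self_eq_norm_sq]
      have h3 := hneg2 l l.2
      have hJ0 : J (v l) ≠ 0 := by
        intro h0
        have := hv l
        rw [hA, h0] at this
        simp at this
        exact hv0 l this
      have : 0 < ‖J (v l)‖ ^ 2 := by positivity
      nlinarith

end Abstract2


section LTwo
open MeasureTheory

/-- Lebesgue measure on the unit interval. -/
noncomputable abbrev mu : Measure ℝ := volume.restrict (Ioc 0 1)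

/-- The Hilbert space of square integrable functions. -/
noncomputable abbrev L2I := Lp ℝ 2 mu

lemma ae_mem : ∀ᵐ x ∂mu, x ∈ Ioc (0:ℝ) 1 := ae_restrict_mem measurableSet_Ioc

lemma memLp_cont (f : C(ℝ, ℝ)) : MemLp f 2 mu := by
  obtain ⟨C, hC⟩ := (isCompact_Icc (a := (0:ℝ)) (b := 1)).exists_bound_of_continuousOn
    f.continuous.continuousOn
  refine MemLp.of_bound f.continuous.aestronglyMeasurable C ?_
  filter_upwards [ae_mem] with x hx
  exact hC x ⟨hx.1.le, hx.2⟩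

/-- Inclusion of continuous functions. -/
noncomputable def cL : C(ℝ, ℝ) →ₗ[ℝ] L2I where
  toFun f := (memLp_cont f).toLp f
  map_add' f g := MemLp.toLp_add (memLp_cont f) (memLp_cont g)
  map_smul' k f := MemLp.toLp_const_smul k (memLp_cont f)

lemma cL_ae (f : C(ℝ, ℝ)) : cL f =ᵐ[mu] f := MemLp.coeFn_toLp (memLp_cont f)

lemma cL_eq_iff (f g : C(ℝ, ℝ)) : cL f = cL g ↔ EqOn f g (Icc 0 1) := by
  constructor
  · intro h
    have h1 : f =ᵐ[mu] g := by
      have h0 := cL_ae f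
      rw [h] at h0
      exact h0.symm.trans (cL_ae g)
    have h2 : f =ᵐ[volume.restrict (Icc 0 1)] g := by
      rwa [mu, Measure.restrict_congr_set Ioc_ae_eq_Icc] at h1
    exact Measure.eqOn_Icc_of_ae_eq volume zero_ne_one h2 f.continuous.continuousOn
      g.continuous.continuousOn
  · intro h
    refine Lp.ext ?_
    filter_upwards [cL_ae f, cL_ae g, ae_mem] with x h1 h2 h3
    rw [h1, h2]; exact h ⟨h3.1.le, h3.2⟩

lemma L2_int (g : L2I) : Integrable g mu := (Lp.memLp g).integrable (by norm_num)

/-- Primitive vanishing at `0`. -/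
noncomputable def prim : L2I →ₗ[ℝ] C(ℝ, ℝ) where
  toFun g := ⟨fun x => ∫ t in (0:ℝ)..x, g t ∂mu,
    intervalIntegral.continuous_primitive (fun a b => (L2_int g).intervalIntegrable) 0⟩
  map_add' f g := by
    ext x
    simp only [ContinuousMap.coe_mk, ContinuousMap.add_apply]
    rw [← intervalIntegral.integral_add (L2_int f).intervalIntegrable (L2_int g).intervalIntegrable]
    refine intervalIntegral.integral_congr_ae' ?_ ?_ <;>
    · filter_upwards [Lp.coeFn_add f g] with x hx _
      simpa using hx
  map_smul' k f := by
    ext x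
    simp only [ContinuousMap.coe_mk, ContinuousMap.smul_apply, RingHom.id_apply]
    rw [← intervalIntegral.integral_smul]
    refine intervalIntegral.integral_congr_ae' ?_ ?_ <;>
    · filter_upwards [Lp.coeFn_smul k f] with x hx _
      simpa using hx

lemma prim_apply (g : L2I) (x : ℝ) : prim g x = ∫ t in (0:ℝ)..x, g t ∂mu := rfl

lemma prim_zero (g : L2I) : prim g 0 = 0 := by simp [prim_apply]

lemma int_mu_eq (f : ℝ → ℝ) {x y : ℝ} (hx : x ∈ Icc (0:ℝ) 1) (hy : y ∈ Icc (0:ℝ) 1) :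
    ∫ t in x..y, f t ∂mu = ∫ t in x..y, f t := by
  have h : ∀ x ∈ Icc (0:ℝ) 1, ∀ y ∈ Icc (0:ℝ) 1, mu.restrict (Ioc x y) = volume.restrict (Ioc x y) := by
    intro x hx y hy
    rw [mu, Measure.restrict_restrict measurableSet_Ioc, inter_eq_left.2]
    exact Ioc_subset_Ioc hx.1 hy.2
  rw [intervalIntegral, intervalIntegral, h x hx y hy, h y hy x hx]

lemma prim_cL (f : C(ℝ, ℝ)) {x : ℝ} (hx : x ∈ Icc (0:ℝ) 1) :
    prim (cL f) x = ∫ t in (0:ℝ)..x, f t := by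
  rw [← int_mu_eq _ (by simp) hx, prim_apply]
  refine intervalIntegral.integral_congr_ae' ?_ ?_ <;>
  · filter_upwards [cL_ae f] with x hx _
    exact hx

/-- derivative of the primitive of a continuous function -/
lemma prim_deriv (f : C(ℝ, ℝ)) {x : ℝ} (hx : x ∈ Icc (0:ℝ) 1) :
    HasDerivWithinAt (prim (cL f)) (f x) (Icc 0 1) x := by
  have h : HasDerivAt (fun y => ∫ t in (0:ℝ)..y, f t) (f x) x :=
    intervalIntegral.integral_hasDerivAt_right (f.continuous.intervalIntegrable _ _)
      f.continuous.stronglyMeasurable.stronglyMeasurableAtFilter f.continuous.continuousAt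
  exact h.hasDerivWithinAt.congr (fun y hy => prim_cL f hy) (prim_cL f hx)

/-- FTC -/
lemma prim_of_deriv (F f : C(ℝ, ℝ)) (h : ∀ x ∈ Icc (0:ℝ) 1, HasDerivWithinAt F (f x) (Icc 0 1) x)
    {x : ℝ} (hx : x ∈ Icc (0:ℝ) 1) : F x = F 0 + prim (cL f) x := by
  rw [prim_cL f hx, intervalIntegral.integral_eq_sub_of_hasDerivAt_of_le hx.1 F.continuous.continuousOn
    _ (f.continuous.intervalIntegrable _ _)]
  · ring
  · intro y hy
    exact (h y ⟨hy.1.le, hy.2.le.trans hx.2⟩).hasDerivAt (Icc_mem_nhds hy.1 (hy.2.trans_le hx.2))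

/-- constant one, and the identity. -/
noncomputable def one : L2I := cL 1
noncomputable def idX : L2I := cL (ContinuousMap.id ℝ)

lemma inner_cL (f g : C(ℝ, ℝ)) : ⟪cL f, cL g⟫ = ∫ x in (0:ℝ)..1, f x * g x := by
  rw [L2.inner_def, intervalIntegral.integral_of_le zero_le_one]
  refine integral_congr_ae ?_
  filter_upwards [cL_ae f, cL_ae g] with x h1 h2
  rw [h1, h2]; simp [mul_comm]

lemma prim_one (g : L2I) : prim g 1 = ⟪one, g⟫ := by
  have hh : mu.restrict (Ioc 0 1) = mu := by
    rw [mu, Measure.restrict_restrict measurableSet_Ioc, inter_self]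
  rw [L2.inner_def, prim_apply, intervalIntegral.integral_of_le zero_le_one, hh]
  refine integral_congr_ae ?_
  filter_upwards [cL_ae 1] with x h1
  simp [one, h1]

lemma prim_sub_le (g : L2I) {x y : ℝ} (hxy : x ≤ y) : |prim g y - prim g x| ≤ √(y - x) * ‖g‖ := by
  have hfin : mu (Ioc x y) ≠ ⊤ := measure_ne_top _ _
  have h1 : prim g y - prim g x = ⟪indicatorConstLp 2 (measurableSet_Ioc (a := x) (b := y)) hfin (1:ℝ), g⟫ := by
    rw [L2.inner_indicatorConstLp_one, prim_apply, prim_apply, intervalIntegral.integral_interval_sub_left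
      (L2_int g).intervalIntegrable (L2_int g).intervalIntegrable, intervalIntegral.integral_of_le hxy]
  rw [h1]
  refine (abs_real_inner_le_norm _ _).trans ?_
  gcongr
  rw [norm_indicatorConstLp (by norm_num) (by norm_num), norm_one, one_mul, Real.sqrt_eq_rpow]
  simp only [ENNReal.toReal_ofNat]
  refine Real.rpow_le_rpow (by positivity) ?_ (by norm_num)
  have := ENNReal.toReal_mono (b := volume (Ioc x y)) (by simp) (Measure.restrict_apply_le (μ := volume) (Ioc 0 1) (Ioc x y))
  simpa [Measure.real, hxy] using this

end LTwo


section LTwoB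
open MeasureTheory

lemma norm_le_ae (f : L2I) {C : ℝ} (hC : 0 ≤ C) (h : ∀ᵐ x ∂mu, |f x| ≤ C) : ‖f‖ ≤ C := by
  have := Lp.norm_le_of_ae_bound (f := f) hC (by simpa [Real.norm_eq_abs] using h)
  simpa [measureUnivNNReal, mu] using this

/-- The Volterra operator. -/
noncomputable def V : L2I →L[ℝ] L2I := (cL ∘ₗ prim).mkContinuous 1 (by
  intro g
  refine norm_le_ae _ (by positivity) ?_
  filter_upwards [cL_ae (prim g), ae_mem] with x hx hx'
  rw [LinearMap.comp_apply, hx]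
  have := prim_sub_le g hx'.1.le
  rw [prim_zero, sub_zero, sub_zero] at this
  refine this.trans ?_
  gcongr
  exact Real.sqrt_le_one.mpr hx'.2)

lemma V_apply (g : L2I) : V g = cL (prim g) := rfl

noncomputable def evP (x : ℝ) (hx : 0 ≤ x) : L2I →L[ℝ] ℝ :=
  LinearMap.mkContinuous
    { toFun := fun g => prim g x
      map_add' := fun f g => by simp
      map_smul' := fun k f => by simp } (√x) (by
    intro g
    have := prim_sub_le g hx
    rw [prim_zero, sub_zero, sub_zero] at this
    exact this)

noncomputable def Phi (n : ℕ) : L2I →L[ℝ] (Fin (n + 2) → ℝ) :=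
  ContinuousLinearMap.pi fun k => evP ((k : ℕ) / ((n + 1 : ℕ) : ℝ)) (by positivity)

noncomputable def stepIdx (n : ℕ) (x : ℝ) : Fin (n + 2) := Fin.ofNat (n + 2) ⌊((n + 1 : ℕ) : ℝ) * x⌋₊

lemma stepIdx_meas (n : ℕ) : Measurable (stepIdx n) :=
  (measurable_from_nat (f := Fin.ofNat (n + 2))).comp
    (Nat.measurable_floor.comp (measurable_const_mul _))

lemma step_memLp (n : ℕ) (a : Fin (n + 2) → ℝ) : MemLp (fun x => a (stepIdx n x)) 2 mu := by
  refine MemLp.of_bound ?_ ‖a‖ ?_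
  · exact ((measurable_of_finite a).comp (stepIdx_meas n)).aestronglyMeasurable
  · exact Filter.Eventually.of_forall fun x => norm_le_pi_norm a _

noncomputable def Psi (n : ℕ) : (Fin (n + 2) → ℝ) →L[ℝ] L2I :=
  LinearMap.mkContinuous
    { toFun := fun a => (step_memLp n a).toLp _
      map_add' := fun f g => MemLp.toLp_add (step_memLp n f) (step_memLp n g)
      map_smul' := fun k f => MemLp.toLp_const_smul k (step_memLp n f) } 1 (by
    intro a
    refine norm_le_ae _ (by positivity) ?_
    filter_upwards [MemLp.coeFn_toLp (step_memLp n a)] with x hx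
    have : |a (stepIdx n x)| ≤ ‖a‖ := norm_le_pi_norm a _
    simpa [hx] using this)

lemma Psi_ae (n : ℕ) (a : Fin (n + 2) → ℝ) : Psi n a =ᵐ[mu] fun x => a (stepIdx n x) :=
  MemLp.coeFn_toLp (step_memLp n a)

lemma V_approx (n : ℕ) (g : L2I) : ‖(Psi n ∘L Phi n - V) g‖ ≤ √(1 / ((n:ℝ) + 1)) * ‖g‖ := by
  refine norm_le_ae _ (by positivity) ?_
  have h0 := Lp.coeFn_sub (Psi n (Phi n g)) (V g)
  filter_upwards [h0, Psi_ae n (Phi n g), cL_ae (prim g), ae_mem] with x h1 h2 h3 h4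
  have e : ((Psi n ∘L Phi n - V) g) = Psi n (Phi n g) - V g := rfl
  rw [e, h1, Pi.sub_apply, h2, V_apply, h3]
  have hn : (0:ℝ) < ((n + 1 : ℕ) : ℝ) := by positivity
  have hfl : ⌊((n + 1 : ℕ) : ℝ) * x⌋₊ < n + 2 := by
    rw [Nat.floor_lt (by have := h4.1; positivity)]
    push_cast
    nlinarith [h4.2]
  have e2 : Phi n g (stepIdx n x) = prim g (⌊((n + 1 : ℕ) : ℝ) * x⌋₊ / ((n + 1 : ℕ) : ℝ)) := by
    have : ((stepIdx n x : Fin (n+2)) : ℕ) = ⌊((n + 1 : ℕ) : ℝ) * x⌋₊ := by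
      rw [stepIdx, Fin.val_ofNat, Nat.mod_eq_of_lt hfl]
    rw [← this]; rfl
  rw [e2]
  have l1 : ⌊((n + 1 : ℕ) : ℝ) * x⌋₊ / ((n + 1 : ℕ) : ℝ) ≤ x := by
    rw [div_le_iff₀ hn, mul_comm x]
    exact Nat.floor_le (by have := h4.1; positivity)
  have l2 : x - ⌊((n + 1 : ℕ) : ℝ) * x⌋₊ / ((n + 1 : ℕ) : ℝ) ≤ 1 / ((n:ℝ) + 1) := by
    have := Nat.lt_floor_add_one (((n + 1 : ℕ) : ℝ) * x)
    have e3 : ((n:ℝ) + 1) = ((n + 1 : ℕ) : ℝ) := by push_cast; ring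
    rw [e3, sub_le_iff_le_add, ← add_div, le_div_iff₀ hn]
    linarith
  rw [abs_sub_comm]
  refine (prim_sub_le g l1).trans ?_
  gcongr

lemma V_compact : IsCompactOperator V := by
  refine isCompactOperator_of_tendsto (l := Filter.atTop) (F := fun n : ℕ => Psi n ∘L Phi n) ?_ ?_
  · rw [tendsto_iff_norm_sub_tendsto_zero]
    refine squeeze_zero (fun n => norm_nonneg _)
      (fun n => ContinuousLinearMap.opNorm_le_bound _ (by positivity) (V_approx n)) ?_
    have := (Real.continuous_sqrt.tendsto 0).comp (tendsto_one_div_add_atTop_nhds_zero_nat (𝕜 := ℝ))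
    simpa [Function.comp_def] using this
  · refine Filter.Eventually.of_forall fun n => ?_
    exact (isCompactOperator_of_locallyCompactSpace_dom (Phi n)).clm_comp (Psi n)

lemma one_norm : ⟪one, one⟫ = 1 := by
  rw [one, inner_cL]; simp

/-- adjoint Volterra operator -/
noncomputable def V' : L2I →L[ℝ] L2I := (innerSL ℝ one).smulRight one - V

lemma V'_apply (f : L2I) : V' f = ⟪one, f⟫ • one - V f := rfl

lemma dense_cL : DenseRange cL := by
  have h := BoundedContinuousFunction.toLp_denseRange ℝ mu ℝ (p := 2) (by norm_num)
  refine Dense.mono ?_ h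
  rintro _ ⟨f, rfl⟩
  exact ⟨f.toContinuousMap, rfl⟩

lemma V_adj (f g : L2I) : ⟪V f, g⟫ = ⟪f, V' g⟫ := by
  refine dense_cL.induction_on₂ (p := fun f g => ⟪V f, g⟫ = ⟪f, V' g⟫) ?_ ?_ f g
  · exact isClosed_eq (by fun_prop) (by fun_prop)
  · intro f g
    rw [V'_apply, inner_sub_right, inner_smul_right, V_apply, V_apply, inner_cL, inner_cL]
    have h1 : ⟪cL f, one⟫ = prim (cL f) 1 := by rw [prim_one, real_inner_comm]
    rw [h1, ← prim_one]
    have := intervalIntegral.integral_mul_deriv_eq_deriv_mul_of_hasDeriv_right (a := 0) (b := 1)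
      (u := prim (cL f)) (v := prim (cL g)) (u' := f) (v' := g)
      (prim (cL f)).continuous.continuousOn (prim (cL g)).continuous.continuousOn
      ?_ ?_ (f.continuous.intervalIntegrable _ _) (g.continuous.intervalIntegrable _ _)
    · rw [this, prim_zero]; ring
    all_goals
      intro x hx
      simp only [zero_le_one, min_eq_left, max_eq_right] at hx
      exact ((prim_deriv _ ⟨hx.1.le, hx.2.le⟩).hasDerivAt (Icc_mem_nhds hx.1 hx.2)).hasDerivWithinAt

lemma V_inj (f : L2I) (h : V f = 0) : f = 0 := by
  have h0 : EqOn (prim f) (0 : C(ℝ, ℝ)) (Icc 0 1) := by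
    rw [← cL_eq_iff, map_zero]; exact h
  have hi : IntervalIntegrable f volume 0 1 := by
    rw [intervalIntegrable_iff_integrableOn_Ioc_of_le zero_le_one]
    exact L2_int f
  have h1 := hi.ae_hasDerivAt_integral
  refine Lp.ext ?_
  have h2 : ∀ᵐ x ∂mu, x ≠ 1 := by
    refine ae_restrict_of_ae ?_
    simp [ae_iff]
  filter_upwards [ae_restrict_of_ae h1, ae_mem, h2, Lp.coeFn_zero ℝ 2 mu] with x h1 h3 h4 h5
  rw [h5]
  have hx : x ∈ uIcc (0:ℝ) 1 := by rw [uIcc_of_le zero_le_one]; exact ⟨h3.1.le, h3.2⟩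
  have h6 := h1 hx 0 (by simp)
  have h7 : (fun x => ∫ t in (0:ℝ)..x, f t) =ᶠ[nhds x] fun _ => 0 := by
    filter_upwards [Icc_mem_nhds h3.1 (lt_of_le_of_ne h3.2 h4)] with y hy
    have := h0 hy
    rw [prim_apply, int_mu_eq _ (by simp) hy] at this
    simpa using this
  exact h6.unique ((hasDerivAt_const x (0:ℝ)).congr_of_eventuallyEq h7)

end LTwoB


section LTwoC
open MeasureTheory

lemma cont_bound (f : C(ℝ, ℝ)) : ∃ C : ℝ, 0 ≤ C ∧ ∀ᵐ x ∂mu, |f x| ≤ C := by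
  obtain ⟨C, hC⟩ := (isCompact_Icc (a := (0:ℝ)) (b := 1)).exists_bound_of_continuousOn
    f.continuous.continuousOn
  refine ⟨C, (norm_nonneg _).trans (hC 0 (by simp)), ?_⟩
  filter_upwards [ae_mem] with x hx
  exact hC x ⟨hx.1.le, hx.2⟩

lemma mul_memLp (f : C(ℝ, ℝ)) (g : L2I) : MemLp (fun x => f x * g x) 2 mu := by
  obtain ⟨C, hC0, hC⟩ := cont_bound f
  refine MemLp.of_le_mul (c := C) (Lp.memLp g)
    (f.continuous.aestronglyMeasurable.mul (Lp.aestronglyMeasurable g)) ?_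
  filter_upwards [hC] with x hx
  rw [norm_mul]
  exact mul_le_mul_of_nonneg_right hx (norm_nonneg _)

/-- multiplication operator -/
noncomputable def mulL (f : C(ℝ, ℝ)) : L2I →L[ℝ] L2I :=
  LinearMap.mkContinuous
    { toFun := fun g => (mul_memLp f g).toLp _
      map_add' := fun g h => by
        refine Lp.ext ?_
        filter_upwards [MemLp.coeFn_toLp (mul_memLp f (g + h)), MemLp.coeFn_toLp (mul_memLp f g),
          MemLp.coeFn_toLp (mul_memLp f h), Lp.coeFn_add g h, 
          Lp.coeFn_add ((mul_memLp f g).toLp _) ((mul_memLp f h).toLp _)] with x h1 h2 h3 h4 h5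
        rw [h1, h5, Pi.add_apply, h2, h3, h4, Pi.add_apply, mul_add]
      map_smul' := fun k g => by
        refine Lp.ext ?_
        filter_upwards [MemLp.coeFn_toLp (mul_memLp f (k • g)), MemLp.coeFn_toLp (mul_memLp f g),
          Lp.coeFn_smul k g, Lp.coeFn_smul k ((mul_memLp f g).toLp _)] with x h1 h2 h4 h5
        rw [RingHom.id_apply, h1, h5, Pi.smul_apply, h2, h4, Pi.smul_apply, smul_eq_mul, smul_eq_mul]
        ring } (cont_bound f).choose (by
    intro g
    refine Lp.norm_le_mul_norm_of_ae_le_mul ?_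
    filter_upwards [MemLp.coeFn_toLp (mul_memLp f g), (cont_bound f).choose_spec.2] with x h1 h2
    simp only [LinearMap.coe_mk, AddHom.coe_mk]
    rw [h1, norm_mul]
    exact mul_le_mul_of_nonneg_right h2 (norm_nonneg _))

lemma mulL_ae (f : C(ℝ, ℝ)) (g : L2I) : mulL f g =ᵐ[mu] fun x => f x * g x :=
  MemLp.coeFn_toLp (mul_memLp f g)

lemma mulL_cL (f g : C(ℝ, ℝ)) : mulL f (cL g) = cL (f * g) := by
  refine Lp.ext ?_
  filter_upwards [mulL_ae f (cL g), cL_ae g, cL_ae (f * g)] with x h1 h2 h3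
  rw [h1, h2, h3]; rfl

lemma mulL_mulL (f g : C(ℝ, ℝ)) (h : L2I) : mulL f (mulL g h) = mulL (f * g) h := by
  refine Lp.ext ?_
  filter_upwards [mulL_ae f (mulL g h), mulL_ae g h, mulL_ae (f * g) h] with x h1 h2 h3
  rw [h1, h2, h3, ContinuousMap.mul_apply, mul_assoc]

lemma mulL_one' (f : C(ℝ, ℝ)) (hf : ∀ x ∈ Icc (0:ℝ) 1, f x = 1) (h : L2I) : mulL f h = h := by
  refine Lp.ext ?_
  filter_upwards [mulL_ae f h, ae_mem] with x h1 h2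
  rw [h1, hf x ⟨h2.1.le, h2.2⟩, one_mul]

lemma mulL_symm (f : C(ℝ, ℝ)) (g h : L2I) : ⟪mulL f g, h⟫ = ⟪g, mulL f h⟫ := by
  rw [L2.inner_def, L2.inner_def]
  refine integral_congr_ae ?_
  filter_upwards [mulL_ae f g, mulL_ae f h] with x h1 h2
  rw [h1, h2]
  simp only [RCLike.inner_apply, conj_trivial]
  ring

/-- positivity -/
lemma mulL_nonneg (f : C(ℝ, ℝ)) (hf : ∀ x ∈ Icc (0:ℝ) 1, 0 ≤ f x) (g : L2I) : 0 ≤ ⟪mulL f g, g⟫ := by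
  rw [L2.inner_def]
  refine integral_nonneg_of_ae ?_
  filter_upwards [mulL_ae f g, ae_mem] with x h1 h2
  rw [h1]
  simp only [RCLike.inner_apply, conj_trivial, Pi.zero_apply]
  have := hf x ⟨h2.1.le, h2.2⟩
  nlinarith [mul_nonneg this (sq_nonneg (g x))]

end LTwoC

section AbsProj
variable {H : Type*} [NormedAddCommGroup H] [InnerProductSpace ℝ H] [CompleteSpace H]

/-- Projection onto the complement of two vectors. -/
lemma exists_proj (a b : H) : ∃ P : H →L[ℝ] H, (∀ x y, ⟪P x, y⟫ = ⟪x, P y⟫) ∧ P a = 0 ∧ P b = 0 ∧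
    (∀ x, ∃ s t : ℝ, P x = x + s • a + t • b) ∧ (∀ x, ⟪a, x⟫ = 0 → ⟪b, x⟫ = 0 → P x = x) ∧
    (∀ x, P (P x) = P x) := by
  let K : Submodule ℝ H := Submodule.span ℝ {a, b}
  have : FiniteDimensional ℝ K := FiniteDimensional.span_of_finite ℝ (by simp)
  have hpa : a ∈ K := Submodule.subset_span (by simp)
  have hpb : b ∈ K := Submodule.subset_span (by simp)
  have hz : ∀ x ∈ K, Kᗮ.starProjection x = 0 := fun x hx => by
    rw [Submodule.starProjection_apply_eq_zero_iff]
    exact K.le_orthogonal_orthogonal hx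
  refine ⟨Kᗮ.starProjection, fun x y => Submodule.inner_starProjection_left_eq_right _ _ _, hz a hpa, hz b hpb, ?_, ?_, ?_⟩
  · intro x
    have h := K.starProjection_add_starProjection_orthogonal x
    have hm : K.starProjection x ∈ K := Submodule.starProjection_apply_mem _ _
    obtain ⟨s, t, hst⟩ := Submodule.mem_span_pair.1 hm
    refine ⟨-s, -t, ?_⟩
    rw [← hst] at h
    nth_rewrite 2 [← h]
    module
  · intro x h1 h2
    rw [Submodule.starProjection_eq_self_iff]
    rw [Submodule.mem_orthogonal]
    intro u hu
    obtain ⟨s, t, rfl⟩ := Submodule.mem_span_pair.1 hu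
    rw [inner_add_left, inner_smul_left, inner_smul_left, h1, h2]; simp
  · intro x
    exact Submodule.starProjection_eq_self_iff.2 (Submodule.starProjection_apply_mem _ _)

end AbsProj


section Calc

/-- `g` is the derivative of `f` on the unit interval. -/
def HD (f g : ℝ → ℝ) : Prop := ∀ x ∈ Icc (0:ℝ) 1, HasDerivWithinAt f (g x) (Icc 0 1) x

lemma udI : UniqueDiffOn ℝ (Icc (0:ℝ) 1) := uniqueDiffOn_Icc zero_lt_one

lemma HD.congr {f g f' g' : ℝ → ℝ} (h : HD f g) (hf : EqOn f' f (Icc 0 1)) (hg : EqOn g' g (Icc 0 1)) :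
    HD f' g' := by
  intro x hx
  rw [hg hx]
  exact (h x hx).congr hf (hf hx)

lemma HD.dv {f g : ℝ → ℝ} (h : HD f g) : EqOn (Dv f) g (Icc 0 1) := fun x hx =>
  (h x hx).derivWithin (udI x hx)

lemma HD.cont {f g : ℝ → ℝ} (h : HD f g) : ContinuousOn f (Icc 0 1) := fun x hx =>
  (h x hx).continuousWithinAt

lemma HD.zero {f g : ℝ → ℝ} (h : HD f g) (hf : ∀ x ∈ Icc (0:ℝ) 1, f x = 0) :
    ∀ x ∈ Icc (0:ℝ) 1, g x = 0 := by
  intro x hx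
  rw [← h.dv hx]
  have h2 : HD f (fun _ => 0) := by
    intro y hy
    exact (hasDerivWithinAt_const y _ (0:ℝ)).congr hf (hf y hy)
  exact h2.dv hx

lemma cd2_of {f g k : ℝ → ℝ} (h1 : HD f g) (h2 : HD g k) (hk : ContinuousOn k (Icc 0 1)) :
    ContDiffOn ℝ 2 f (Icc 0 1) ∧ EqOn (Dv f) g (Icc 0 1) ∧ EqOn (Dv (Dv f)) k (Icc 0 1) := by
  have e1 := h1.dv
  have h3 : HD (Dv f) k := h2.congr e1 (fun x _ => rfl)
  refine ⟨?_, e1, h3.dv⟩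
  have : (2 : WithTop ℕ∞) = 1 + 1 := by norm_num
  rw [this, contDiffOn_succ_iff_derivWithin udI]
  refine ⟨fun x hx => (h1 x hx).differentiableWithinAt, by simp, ?_⟩
  have : (1 : WithTop ℕ∞) = 0 + 1 := by norm_num
  rw [this, contDiffOn_succ_iff_derivWithin udI]
  refine ⟨fun x hx => (h3 x hx).differentiableWithinAt, by simp, ?_⟩
  rw [contDiffOn_zero]
  exact hk.congr h3.dv

lemma of_cd2 {f : ℝ → ℝ} (h : ContDiffOn ℝ 2 f (Icc 0 1)) :
    HD f (Dv f) ∧ HD (Dv f) (Dv (Dv f)) ∧ ContinuousOn (Dv (Dv f)) (Icc 0 1) := by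
  have e : (2 : WithTop ℕ∞) = 1 + 1 := by norm_num
  rw [e, contDiffOn_succ_iff_derivWithin udI] at h
  have e : (1 : WithTop ℕ∞) = 0 + 1 := by norm_num
  obtain ⟨h1, -, h2⟩ := h
  rw [e, contDiffOn_succ_iff_derivWithin udI] at h2
  refine ⟨fun x hx => (h1 x hx).hasDerivWithinAt, fun x hx => (h2.1 x hx).hasDerivWithinAt, ?_⟩
  exact contDiffOn_zero.1 h2.2.2

lemma exists_ext {f : ℝ → ℝ} (hf : ContinuousOn f (Icc 0 1)) : ∃ F : C(ℝ, ℝ), EqOn F f (Icc 0 1) := by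
  refine ⟨⟨IccExtend zero_le_one ((Icc (0:ℝ) 1).domRestrict f),
    (continuousOn_iff_continuous_domRestrict.1 hf).Icc_extend'⟩, ?_⟩
  intro x hx
  exact (IccExtend_of_mem zero_le_one ((Icc (0:ℝ) 1).domRestrict f) hx)

lemma gron {E : Type*} [NormedAddCommGroup E] [NormedSpace ℝ E] (f f' : ℝ → E) (K : ℝ)
    (hf : ∀ x ∈ Icc (0:ℝ) 1, HasDerivWithinAt f (f' x) (Icc 0 1) x)
    (hK : ∀ x ∈ Icc (0:ℝ) 1, ‖f' x‖ ≤ K * ‖f x‖) (h0 : f 0 = 0) : ∀ x ∈ Icc (0:ℝ) 1, f x = 0 := by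
  refine eq_zero_of_abs_deriv_le_mul_abs_self_of_eq_zero_right (f' := f') (K := K)
    (fun x hx => (hf x hx).continuousWithinAt) ?_ h0 ?_
  · intro x hx
    refine (hf x ⟨hx.1, hx.2.le⟩).mono_of_mem_nhdsWithin ?_
    exact Icc_mem_nhdsGE_of_mem hx
  · intro x hx
    exact hK x ⟨hx.1, hx.2.le⟩

lemma mono_HD {f g : ℝ → ℝ} (h : HD f g) {s t : ℝ} (hs : 0 ≤ s) (ht : t ≤ 1)
    (hg : ∀ x ∈ Icc s t, 0 ≤ g x) {x y : ℝ} (hx : s ≤ x) (hxy : x ≤ y) (hy : y ≤ t) : f x ≤ f y := by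
  have hsub : Icc s t ⊆ Icc (0:ℝ) 1 := Icc_subset_Icc hs ht
  have hm : MonotoneOn f (Icc s t) := by
    refine monotoneOn_of_hasDerivWithinAt_nonneg (convex_Icc s t) (h.cont.mono hsub)
      (f' := g) ?_ ?_
    · intro x hx
      exact (h x (hsub (interior_subset hx))).mono (interior_subset.trans hsub)
    · intro x hx
      exact hg x (interior_subset hx)
  exact hm ⟨hx, hxy.trans hy⟩ ⟨hx.trans hxy, hy⟩ hxy

end Calc

section Sys

/-- second order system -/
structure Sys2 (r : C(ℝ, ℝ)) (c l : ℝ) (U w : C(ℝ, ℝ)) : Prop where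
  hU : HD U w
  hw : HD w (fun x => (c * r x - l) * U x)
  U0 : U 0 = 0
  U1 : U 1 = 0

/-- fourth order system, `i` is the inverse of `p` -/
structure Sys4 (i r : C(ℝ, ℝ)) (c l : ℝ) (Y z m n : C(ℝ, ℝ)) : Prop where
  hY : HD Y z
  hz : HD z (fun x => i x * m x)
  hm : HD m n
  hn : HD n (fun x => l * (-(i x * m x) + c * r x * Y x))
  Y0 : Y 0 = 0
  Y1 : Y 1 = 0
  z0 : z 0 = 0
  z1 : z 1 = 0

lemma cbound (f : C(ℝ, ℝ)) : ∃ C : ℝ, 0 ≤ C ∧ ∀ x ∈ Icc (0:ℝ) 1, |f x| ≤ C := by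
  obtain ⟨C, hC⟩ := (isCompact_Icc (a := (0:ℝ)) (b := 1)).exists_bound_of_continuousOn
    f.continuous.continuousOn
  exact ⟨C, (norm_nonneg _).trans (hC 0 (by simp)), hC⟩

lemma Sys2.unique {r : C(ℝ, ℝ)} {c l : ℝ} {U w : C(ℝ, ℝ)} (h : Sys2 r c l U w) (h0 : w 0 = 0) :
    ∀ x ∈ Icc (0:ℝ) 1, w x = 0 := by
  obtain ⟨C, hC0, hC⟩ := cbound r
  have key := gron (fun x => (U x, w x)) (fun x => (w x, (c * r x - l) * U x)) (1 + |c| * C + |l|)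
    (fun x hx => (h.hU x hx).prodMk (h.hw x hx)) ?_ (by simp [h.U0, h0])
  · intro x hx
    have := key x hx
    simp only [Prod.mk_eq_zero] at this
    exact this.2
  · intro x hx
    simp only [Prod.norm_def, Real.norm_eq_abs]
    set M := max |U x| |w x|
    have hM0 : 0 ≤ M := (abs_nonneg _).trans (le_max_left _ _)
    have h1 : |U x| ≤ M := le_max_left _ _
    have h2 : |w x| ≤ M := le_max_right _ _
    refine max_le ?_ ?_
    · have : 0 ≤ (|c| * C + |l|) * M := by positivity
      nlinarith
    · rw [abs_mul]
      have : |c * r x - l| ≤ |c| * C + |l| := by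
        refine (abs_sub _ _).trans ?_
        rw [abs_mul]
        gcongr
        exact hC x hx
      calc _ ≤ (|c| * C + |l|) * M := by gcongr
        _ ≤ _ := by nlinarith

lemma Sys4.unique0 {i r : C(ℝ, ℝ)} {c l : ℝ} {Y z m n : C(ℝ, ℝ)} (h : Sys4 i r c l Y z m n)
    (h0 : m 0 = 0) (h1 : n 0 = 0) : ∀ x ∈ Icc (0:ℝ) 1, m x = 0 := by
  obtain ⟨C, hC0, hC⟩ := cbound r
  obtain ⟨D, hD0, hD⟩ := cbound i
  have key := gron (fun x => (Y x, z x, m x, n x))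
    (fun x => (z x, i x * m x, n x, l * (-(i x * m x) + c * r x * Y x)))
    (1 + D + |l| * (D + |c| * C))
    (fun x hx => (h.hY x hx).prodMk ((h.hz x hx).prodMk ((h.hm x hx).prodMk (h.hn x hx)))) ?_
    (by simp [h.Y0, h.z0, h0, h1])
  · intro x hx
    have := key x hx
    simp only [Prod.mk_eq_zero] at this
    exact this.2.2.1
  · intro x hx
    simp only [Prod.norm_def, Real.norm_eq_abs]
    set M := max |Y x| (max |z x| (max |m x| |n x|))
    have l1 : |Y x| ≤ M := le_max_left _ _
    have l2 : |z x| ≤ M := (le_max_left _ _).trans (le_max_right _ _)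
    have l3 : |m x| ≤ M := (le_max_left _ _).trans ((le_max_right _ _).trans (le_max_right _ _))
    have l4 : |n x| ≤ M := (le_max_right _ _).trans ((le_max_right _ _).trans (le_max_right _ _))
    have hM0 : 0 ≤ M := (abs_nonneg _).trans l1
    have g1 : 0 ≤ D * M := by positivity
    have g2 : 0 ≤ |l| * (D + |c| * C) * M := by positivity
    have g3 : |i x * m x| ≤ D * M := by
      rw [abs_mul]
      have := hD x hx
      gcongr
    refine max_le ?_ (max_le ?_ (max_le ?_ ?_))
    · nlinarith
    · nlinarith
    · nlinarith
    · rw [abs_mul]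
      have : |-(i x * m x) + c * r x * Y x| ≤ (D + |c| * C) * M := by
        refine (abs_add_le _ _).trans ?_
        rw [abs_neg, abs_mul (c * r x), abs_mul c, add_mul]
        have := hC x hx
        gcongr
      calc _ ≤ |l| * ((D + |c| * C) * M) := by gcongr
        _ ≤ _ := by nlinarith

lemma Sys4.neg {i r : C(ℝ, ℝ)} {c l : ℝ} {Y z m n : C(ℝ, ℝ)} (h : Sys4 i r c l Y z m n) :
    Sys4 i r c l (-Y) (-z) (-m) (-n) where
  hY := fun x hx => (h.hY x hx).neg
  hz := fun x hx => (h.hz x hx).neg.congr_deriv (by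
    change -(i x * m x) = i x * -(m x)
    ring)
  hm := fun x hx => (h.hm x hx).neg
  hn := fun x hx => (h.hn x hx).neg.congr_deriv (by
    change _ = l * (-(i x * -(m x)) + c * r x * -(Y x))
    ring)
  Y0 := by simp [h.Y0]
  Y1 := by simp [h.Y1]
  z0 := by simp [h.z0]
  z1 := by simp [h.z1]

lemma Sys4.pos {i r : C(ℝ, ℝ)} {c l : ℝ} {Y z m n : C(ℝ, ℝ)} (h : Sys4 i r c l Y z m n)
    (hi : ∀ x ∈ Icc (0:ℝ) 1, 0 < i x) (hr : ∀ x ∈ Icc (0:ℝ) 1, 0 < r x) (hc : c < 0) (hl : l < 0)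
    (h0 : m 0 = 0) (h1 : 0 < n 0) : False := by
  set b := n 0 with hb
  let s : Set ℝ := {t | 0 ≤ m t ∧ 0 ≤ z t ∧ 0 ≤ Y t ∧ b ≤ n t}
  have hsc : IsClosed s := by
    refine (isClosed_le continuous_const m.continuous).inter
      ((isClosed_le continuous_const z.continuous).inter
      ((isClosed_le continuous_const Y.continuous).inter (isClosed_le continuous_const n.continuous)))
  have hall : Icc (0:ℝ) 1 ⊆ s := by
    refine IsClosed.Icc_subset_of_forall_exists_gt (hsc.inter isClosed_Icc) ?_ ?_
    · exact ⟨h0.ge, h.z0.ge, h.Y0.ge, le_rfl⟩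
    · rintro t ⟨⟨t1, t2, t3, t4⟩, ht⟩ y hy
      have hn0 : ∀ᶠ x in nhds t, 0 < n x :=
        n.continuous.continuousAt.eventually (lt_mem_nhds (h1.trans_le t4))
      obtain ⟨e, he, hball⟩ := Metric.eventually_nhds_iff.1 hn0
      let t' := min (min y 1) (t + e / 2)
      have htt' : t < t' := lt_min (lt_min hy ht.2) (by linarith)
      have ht'1 : t' ≤ 1 := (min_le_left _ _).trans (min_le_right _ _)
      have hpos : ∀ x ∈ Icc t t', 0 ≤ n x := by
        intro x hx
        refine (hball ?_).le
        have : t' ≤ t + e / 2 := min_le_right _ _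
        rw [Real.dist_eq, abs_lt]
        constructor <;> linarith [hx.1, hx.2]
      have hI : Icc t t' ⊆ Icc (0:ℝ) 1 := Icc_subset_Icc ht.1 ht'1
      have a1 : ∀ x ∈ Icc t t', 0 ≤ m x := fun x hx =>
        t1.trans (mono_HD h.hm ht.1 ht'1 hpos le_rfl hx.1 hx.2)
      have a1' : ∀ x ∈ Icc t t', 0 ≤ i x * m x := fun x hx =>
        mul_nonneg (hi x (hI hx)).le (a1 x hx)
      have a2 : ∀ x ∈ Icc t t', 0 ≤ z x := fun x hx =>
        t2.trans (mono_HD h.hz ht.1 ht'1 a1' le_rfl hx.1 hx.2)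
      have a3 : ∀ x ∈ Icc t t', 0 ≤ Y x := fun x hx =>
        t3.trans (mono_HD h.hY ht.1 ht'1 a2 le_rfl hx.1 hx.2)
      have a4 : ∀ x ∈ Icc t t', 0 ≤ l * (-(i x * m x) + c * r x * Y x) := by
        intro x hx
        refine mul_nonneg_of_nonpos_of_nonpos hl.le ?_
        have := mul_nonneg (hr x (hI hx)).le (a3 x hx)
        have := a1' x hx
        nlinarith
      have a5 := mono_HD h.hn ht.1 ht'1 a4 le_rfl htt'.le le_rfl
      have hm' : t' ∈ Icc t t' := ⟨htt'.le, le_rfl⟩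
      exact ⟨t', ⟨a1 _ hm', a2 _ hm', a3 _ hm', t4.trans a5⟩, htt', (min_le_left _ _).trans (min_le_left _ _)⟩
  have hz0 : ∀ x ∈ Icc (0:ℝ) 1, z x = 0 := by
    intro x hx
    refine le_antisymm ?_ (hall hx).2.1
    rw [← h.z1]
    refine mono_HD h.hz le_rfl le_rfl (fun y hy => ?_) hx.1 hx.2 le_rfl
    exact mul_nonneg (hi y hy).le (hall hy).1
  have hm0 : ∀ x ∈ Icc (0:ℝ) 1, m x = 0 := by
    intro x hx
    have := h.hz.zero hz0 x hx
    exact (mul_eq_zero.1 this).resolve_left (hi x hx).ne'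
  exact h1.ne' (h.hm.zero hm0 0 (by simp))

lemma Sys4.unique {i r : C(ℝ, ℝ)} {c l : ℝ} {Y z m n : C(ℝ, ℝ)} (h : Sys4 i r c l Y z m n)
    (hi : ∀ x ∈ Icc (0:ℝ) 1, 0 < i x) (hr : ∀ x ∈ Icc (0:ℝ) 1, 0 < r x) (hc : c < 0) (hl : l < 0)
    (h0 : m 0 = 0) : ∀ x ∈ Icc (0:ℝ) 1, m x = 0 := by
  rcases lt_trichotomy (n 0) 0 with h1 | h1 | h1
  · exact (h.neg.pos hi hr hc hl (by simp [h0]) (by simpa using h1)).elim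
  · exact h.unique0 h0 h1
  · exact (h.pos hi hr hc hl h0 h1).elim

end Sys


section Classical2

lemma zero_memI : (0:ℝ) ∈ Icc (0:ℝ) 1 := by simp
lemma one_memI : (1:ℝ) ∈ Icc (0:ℝ) 1 := by simp

lemma N2_iff (r : ℝ → ℝ) (c l : ℝ) (R : C(ℝ, ℝ)) (hR : EqOn R r (Icc 0 1)) :
    (∃ u : ℝ → ℝ, ContDiffOn ℝ 2 u (Icc 0 1) ∧
        (∀ x ∈ Icc (0:ℝ) 1, -(Dv (Dv u) x) + c * r x * u x = l * u x) ∧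
        Nontriv u ∧ u 0 = 0 ∧ u 1 = 0) ↔
    ∃ U w : C(ℝ, ℝ), Sys2 R c l U w ∧ ¬ ∀ x ∈ Icc (0:ℝ) 1, U x = 0 := by
  constructor
  · rintro ⟨u, hu, he, ⟨x, hx, hxu⟩, h0, h1⟩
    obtain ⟨d1, d2, -⟩ := of_cd2 hu
    obtain ⟨U, hU⟩ := exists_ext d1.cont
    obtain ⟨w, hw⟩ := exists_ext d2.cont
    refine ⟨U, w, ⟨d1.congr hU hw, d2.congr hw ?_, ?_, ?_⟩, ?_⟩
    · intro y hy
      have := he y hy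
      simp only
      rw [hU hy, hR hy]
      linarith
    · rw [hU zero_memI, h0]
    · rw [hU one_memI, h1]
    · intro h
      exact hxu (by rw [← hU hx, h x hx])
  · rintro ⟨U, w, h, hne⟩
    obtain ⟨c1, c2, c3⟩ := cd2_of h.hU h.hw (by fun_prop)
    refine ⟨U, c1, ?_, ?_, h.U0, h.U1⟩
    · intro x hx
      rw [c3 hx, ← hR hx]
      ring
    · push Not at hne
      exact hne

lemma N4_iff (p r : ℝ → ℝ) (c l : ℝ) (i R : C(ℝ, ℝ)) (hR : EqOn R r (Icc 0 1))
    (hi : ∀ x ∈ Icc (0:ℝ) 1, i x * p x = 1) :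
    EigT1 p r c l ↔
    ∃ Y z m n : C(ℝ, ℝ), Sys4 i R c l Y z m n ∧ ¬ ∀ x ∈ Icc (0:ℝ) 1, Y x = 0 := by
  constructor
  · rintro ⟨y, ⟨hy1, hy2, he⟩, ⟨x, hx, hxu⟩, b1, b2, b3, b4⟩
    obtain ⟨d1, d2, -⟩ := of_cd2 hy1
    obtain ⟨d3, d4, -⟩ := of_cd2 hy2
    obtain ⟨Y, hY⟩ := exists_ext d1.cont
    obtain ⟨z, hz⟩ := exists_ext d2.cont
    obtain ⟨m, hm⟩ := exists_ext d3.cont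
    obtain ⟨n, hn⟩ := exists_ext d4.cont
    have him : ∀ x ∈ Icc (0:ℝ) 1, i x * m x = Dv (Dv y) x := by
      intro x hx
      rw [hm hx]
      simp only
      rw [← mul_assoc, hi x hx, one_mul]
    refine ⟨Y, z, m, n, ⟨d1.congr hY hz, d2.congr hz him, d3.congr hm hn, d4.congr hn ?_, ?_, ?_, ?_, ?_⟩, ?_⟩
    · intro x hx
      have := he x hx
      simp only
      rw [him x hx, hY hx, hR hx]
      linarith
    · rw [hY zero_memI, b1]
    · rw [hY one_memI, b3]
    · rw [hz zero_memI, b2]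
    · rw [hz one_memI, b4]
    · intro h
      exact hxu (by rw [← hY hx, h x hx])
  · rintro ⟨Y, z, m, n, h, hne⟩
    obtain ⟨c1, c2, c3⟩ := cd2_of h.hY h.hz (by fun_prop)
    have e1 : EqOn (fun x => p x * Dv (Dv Y) x) m (Icc 0 1) := by
      intro x hx
      simp only
      rw [c3 hx, ← mul_assoc, mul_comm (p x), hi x hx, one_mul]
    have hm' : HD (fun x => p x * Dv (Dv Y) x) n := h.hm.congr e1 (fun x _ => rfl)
    obtain ⟨c4, c5, c6⟩ := cd2_of hm' h.hn (by fun_prop)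
    refine ⟨Y, ⟨c1, c4, ?_⟩, ?_, h.Y0, ?_, h.Y1, ?_⟩
    · intro x hx
      rw [c6 hx, c3 hx, ← hR hx]
      ring
    · push Not at hne
      exact hne
    · rw [c2 zero_memI, h.z0]
    · rw [c2 one_memI, h.z1]

end Classical2

section Ops

/-- projection onto mean zero functions -/
noncomputable def P0 : L2I →L[ℝ] L2I := ContinuousLinearMap.id ℝ L2I - (innerSL ℝ one).smulRight one

lemma P0_apply (f : L2I) : P0 f = f - ⟪one, f⟫ • one := rfl

lemma P0_one : P0 one = 0 := by rw [P0_apply, one_norm]; simp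

lemma inner_P0 (f : L2I) : ⟪one, P0 f⟫ = 0 := by
  rw [P0_apply, inner_sub_right, inner_smul_right, one_norm]; ring

lemma P0_of (f : L2I) (h : ⟪one, f⟫ = 0) : P0 f = f := by
  rw [P0_apply, h]; simp

lemma P0_P0 (f : L2I) : P0 (P0 f) = P0 f := P0_of _ (inner_P0 f)

lemma P0_symm (f g : L2I) : ⟪P0 f, g⟫ = ⟪f, P0 g⟫ := by
  rw [P0_apply, P0_apply, inner_sub_left, inner_sub_right, inner_smul_left, inner_smul_right,
    real_inner_comm one f]
  simp only [conj_trivial]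
  ring

noncomputable def Jop : L2I →L[ℝ] L2I := V ∘L P0
noncomputable def Jop' : L2I →L[ℝ] L2I := P0 ∘L V'

lemma Jop_adj (f g : L2I) : ⟪Jop f, g⟫ = ⟪f, Jop' g⟫ := by
  change ⟪V (P0 f), g⟫ = ⟪f, P0 (V' g)⟫
  rw [V_adj, P0_symm]

lemma Jop'_apply (f : L2I) : Jop' f = - P0 (V f) := by
  change P0 (V' f) = _
  rw [V'_apply, map_sub, map_smul, P0_one]; simp

lemma V'_of (f : L2I) (h : ⟪one, f⟫ = 0) : V' f = - V f := by
  rw [V'_apply, h]; simp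

lemma V_one : V one = idX := by
  rw [V_apply, idX, cL_eq_iff]
  intro x hx
  rw [one, prim_cL 1 hx]
  simp

/-- FTC in operator form -/
lemma V_cL_of_HD {F f : C(ℝ, ℝ)} (h : HD F f) : V (cL f) = cL F - F 0 • one := by
  have : cL F - F 0 • one = cL (F - F 0 • 1) := by rw [map_sub, map_smul]; rfl
  rw [this, V_apply, cL_eq_iff]
  intro x hx
  have := prim_of_deriv F f h hx
  simp
  linarith

lemma HD_prim (f : C(ℝ, ℝ)) : HD (prim (cL f)) f := fun _ hx => prim_deriv f hx

lemma inner_one_of_HD {F f : C(ℝ, ℝ)} (h : HD F f) : ⟪one, cL f⟫ = F 1 - F 0 := by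
  rw [← prim_one, prim_of_deriv F f h one_memI]; ring

/-- the operator `1 + J' R J` -/
noncomputable def Aop (r : C(ℝ, ℝ)) (c : ℝ) : L2I →L[ℝ] L2I :=
  ContinuousLinearMap.id ℝ L2I + Jop' ∘L (mulL (c • r)) ∘L Jop

lemma Aop_apply (r : C(ℝ, ℝ)) (c : ℝ) (f : L2I) : Aop r c f = f + Jop' (mulL (c • r) (Jop f)) := rfl

lemma Sys2.op {r : C(ℝ, ℝ)} {c l : ℝ} {U w : C(ℝ, ℝ)} (h : Sys2 r c l U w) :
    P0 (cL w) = cL w ∧ Aop r c (cL w) = l • Jop' (Jop (cL w)) := by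
  have h1 : P0 (cL w) = cL w := P0_of _ (by rw [inner_one_of_HD h.hU, h.U0, h.U1, sub_zero])
  have h2 : Jop (cL w) = cL U := by
    change V (P0 (cL w)) = _
    rw [h1, V_cL_of_HD h.hU, h.U0]; simp
  refine ⟨h1, ?_⟩
  rw [Aop_apply, h2, ← map_smul, ← sub_eq_zero, add_sub_assoc, ← map_sub, mulL_cL, ← map_smul, ← map_sub]
  have h3 : HD w ((c • r) * U - l • U : C(ℝ, ℝ)) := by
    refine h.hw.congr (fun x _ => rfl) (fun x _ => ?_)
    simp; ring
  rw [Jop'_apply, V_cL_of_HD h3, map_sub, map_smul, P0_one, h1]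
  simp

lemma Sys2.of_op {r : C(ℝ, ℝ)} {c l : ℝ} {v : L2I} (h : Aop r c v = l • Jop' (Jop v)) :
    ∃ U w, Sys2 r c l U w ∧ v = cL w := by
  let U := prim (P0 v)
  have h2 : Jop v = cL U := rfl
  let k : C(ℝ, ℝ) := (c • r) * U - l • U
  have h3 : v = P0 (V (cL k)) := by
    rw [Aop_apply, h2, ← map_smul, ← sub_eq_zero, add_sub_assoc, ← map_sub, mulL_cL, ← map_smul, ← map_sub,
      Jop'_apply, ← sub_eq_add_neg, sub_eq_zero] at h
    exact h
  have h4 : P0 v = v := by rw [h3, P0_P0]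
  let w : C(ℝ, ℝ) := prim (cL k) - ⟪one, V (cL k)⟫ • 1
  have h5 : v = cL w := by
    rw [h3, P0_apply, map_sub, map_smul]; rfl
  refine ⟨U, w, ⟨?_, ?_, prim_zero _, ?_⟩, h5⟩
  · have := HD_prim w
    rw [← h5] at this
    change HD (prim (P0 v)) w
    rwa [h4]
  · intro x hx
    have := (HD_prim k x hx).sub_const (⟪one, V (cL k)⟫)
    refine (this.congr_deriv ?_).congr ?_ ?_
    · simp [k]; ring
    · intro y _; simp [w]
    · simp [w]
  · change prim (P0 v) 1 = 0
    rw [prim_one, inner_P0]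

end Ops


section Ops4

/-- properties of the projection orthogonal to `s` and `x s` -/
structure IsProj (s : C(ℝ, ℝ)) (P : L2I →L[ℝ] L2I) : Prop where
  symm : ∀ x y, ⟪P x, y⟫ = ⟪x, P y⟫
  a0 : P (mulL s one) = 0
  b0 : P (mulL s idX) = 0
  form : ∀ x, ∃ α β : ℝ, P x = x + α • mulL s one + β • mulL s idX
  fix : ∀ x, ⟪mulL s one, x⟫ = 0 → ⟪mulL s idX, x⟫ = 0 → P x = x
  idem : ∀ x, P (P x) = P x

lemma exists_isProj (s : C(ℝ, ℝ)) : ∃ P, IsProj s P := by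
  obtain ⟨P, h1, h2, h3, h4, h5, h6⟩ := exists_proj (mulL s one) (mulL s idX)
  exact ⟨P, h1, h2, h3, h4, h5, h6⟩

noncomputable def Wop (s : C(ℝ, ℝ)) (P : L2I →L[ℝ] L2I) : L2I →L[ℝ] L2I := V ∘L mulL s ∘L P
noncomputable def Wop' (s : C(ℝ, ℝ)) (P : L2I →L[ℝ] L2I) : L2I →L[ℝ] L2I := P ∘L mulL s ∘L V'

lemma Wop_apply (s : C(ℝ, ℝ)) (P : L2I →L[ℝ] L2I) (f : L2I) : Wop s P f = V (mulL s (P f)) := rfl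
lemma Wop'_apply (s : C(ℝ, ℝ)) (P : L2I →L[ℝ] L2I) (f : L2I) : Wop' s P f = P (mulL s (V' f)) := rfl

lemma Wop_adj {s : C(ℝ, ℝ)} {P : L2I →L[ℝ] L2I} (hP : IsProj s P) (f g : L2I) :
    ⟪Wop s P f, g⟫ = ⟪f, Wop' s P g⟫ := by
  rw [Wop_apply, Wop'_apply, V_adj, mulL_symm, hP.symm]

lemma V'A (r : C(ℝ, ℝ)) (c : ℝ) {Y z : C(ℝ, ℝ)} (h : HD Y z) (h0 : Y 0 = 0) (h1 : Y 1 = 0) :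
    ∃ t : ℝ, V' (Aop r c (cL z)) = -cL Y + V (V (cL ((c • r) * Y))) - t • idX := by
  have e0 : ⟪one, cL z⟫ = 0 := by rw [inner_one_of_HD h, h0, h1, sub_zero]
  have e1 : Jop (cL z) = cL Y := by
    change V (P0 (cL z)) = _
    rw [P0_of _ e0, V_cL_of_HD h, h0]; simp
  refine ⟨⟪one, V (cL ((c • r) * Y))⟫, ?_⟩
  rw [Aop_apply, e1, mulL_cL, map_add, V'_of _ e0, V_cL_of_HD h, h0, Jop'_apply, map_neg,
    V'_of _ (inner_P0 _), P0_apply, map_sub, map_smul, V_one]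
  module

lemma Sys4.op {s r : C(ℝ, ℝ)} {c l : ℝ} {Y z m n : C(ℝ, ℝ)} (h : Sys4 (s * s) r c l Y z m n)
    {P : L2I →L[ℝ] L2I} (hP : IsProj s P) :
    l • Wop' s P (Aop r c (Wop s P (cL (s * m)))) = cL (s * m) := by
  have hz : HD z (s * (s * m) : C(ℝ, ℝ)) := by
    rw [← mul_assoc]; exact h.hz
  have e0 : V (cL (s * (s * m))) = cL z := by rw [V_cL_of_HD hz, h.z0]; simp
  have i1 : ⟪one, cL (s * (s * m))⟫ = 0 := by rw [inner_one_of_HD hz, h.z0, h.z1, sub_zero]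
  have e1 : P (cL (s * m)) = cL (s * m) := by
    refine hP.fix _ ?_ ?_
    · rw [mulL_symm, mulL_cL, i1]
    · rw [mulL_symm, mulL_cL, ← V_one, V_adj, V'_of _ i1, e0, inner_neg_right, inner_one_of_HD h.hY,
        h.Y0, h.Y1]; simp
  obtain ⟨t, ht⟩ := V'A r c h.hY h.Y0 h.Y1
  rw [Wop_apply, e1, mulL_cL, e0, Wop'_apply, ht, map_sub, map_smul, map_sub, map_smul, hP.b0, smul_zero,
    sub_zero, ← map_smul, ← map_smul]
  have hn : HD n (l • (-(s * (s * m)) + (c • r) * Y) : C(ℝ, ℝ)) := by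
    refine h.hn.congr (fun x _ => rfl) (fun x _ => ?_)
    simp; ring
  have e2 : V (V (cL (l • (-(s * (s * m)) + (c • r) * Y)))) = cL m - m 0 • one - n 0 • idX := by
    rw [V_cL_of_HD hn, map_sub, V_cL_of_HD h.hm, map_smul, V_one]
  have e3 : V (V (cL (l • (-(s * (s * m)) + (c • r) * Y)))) = l • (-cL Y + V (V (cL ((c • r) * Y)))) := by
    rw [map_smul, map_add, map_neg, map_smul, map_smul, map_add, map_add, map_neg, map_neg, e0,
      V_cL_of_HD h.hY, h.Y0]; simp
  rw [← e3, e2, map_sub, map_sub, map_smul, map_smul, map_sub, map_sub, map_smul, map_smul, hP.a0, hP.b0,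
    mulL_cL, e1]
  simp

lemma Sys4.of_op {s r : C(ℝ, ℝ)} {c l : ℝ} {P : L2I →L[ℝ] L2I} (hP : IsProj s P) {v : L2I}
    (h : l • Wop' s P (Aop r c (Wop s P v)) = v) :
    ∃ Y z m n, Sys4 (s * s) r c l Y z m n ∧ v = cL (s * m) := by
  have hv : P v = v := by rw [← h, map_smul, Wop'_apply, hP.idem]
  have i1 : ⟪one, mulL s v⟫ = 0 := by
    rw [← mulL_symm, ← hv, ← hP.symm, hP.a0, inner_zero_left]
  have i2 : ⟪idX, mulL s v⟫ = 0 := by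
    rw [← mulL_symm, ← hv, ← hP.symm, hP.b0, inner_zero_left]
  let z := prim (mulL s v)
  have hz1 : z 1 = 0 := by
    change prim (mulL s v) 1 = 0
    rw [prim_one, i1]
  have eW : Wop s P v = cL z := by rw [Wop_apply, hv]; rfl
  let Y := prim (cL z)
  have hY : HD Y z := HD_prim z
  have hY0 : Y 0 = 0 := prim_zero _
  have hY1 : Y 1 = 0 := by
    change prim (cL z) 1 = 0
    rw [prim_one]
    have : cL z = V (mulL s v) := rfl
    rw [this, real_inner_comm, V_adj, V'_apply, one_norm, V_one, one_smul, inner_sub_right,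
      real_inner_comm, i1, real_inner_comm, i2, sub_zero]
  obtain ⟨t, ht⟩ := V'A r c hY hY0 hY1
  let k : C(ℝ, ℝ) := (c • r) * Y
  let g : C(ℝ, ℝ) := -Y + prim (cL (prim (cL k)))
  have eg : -cL Y + V (V (cL ((c • r) * Y))) = cL g := by
    change _ = cL (-Y + prim (cL (prim (cL k))))
    rw [map_add, map_neg]; rfl
  rw [eg] at ht
  rw [eW, Wop'_apply, ht, map_sub, map_smul, map_sub, map_smul, hP.b0, smul_zero, sub_zero] at h
  obtain ⟨α, β, hf⟩ := hP.form (mulL s (cL g))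
  let m : C(ℝ, ℝ) := l • g + (l * α) • 1 + (l * β) • ContinuousMap.id ℝ
  let n : C(ℝ, ℝ) := l • (-z + prim (cL k)) + (l * β) • 1
  have em : v = cL (s * m) := by
    rw [← mulL_cL, ← h, hf]
    have e : cL m = l • cL g + (l * α) • one + (l * β) • idX := by
      simp only [m, map_add cL, map_smul cL]
      rfl
    rw [e]
    generalize cL g = G
    rw [map_add, map_add, map_smul, map_smul, map_smul]
    module
  have hz : HD z (s * (s * m) : C(ℝ, ℝ)) := by
    have := HD_prim (s * (s * m))
    rwa [← mulL_cL, ← em] at this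
  refine ⟨Y, z, m, n, ⟨hY, ?_, ?_, ?_, hY0, hY1, prim_zero _, hz1⟩, em⟩
  · rw [← mul_assoc] at hz; exact hz
  · intro x hx
    have d1 := ((hY x hx).neg.add (HD_prim (prim (cL k)) x hx)).const_mul l
    have d2 := (d1.add_const (l * α)).add ((hasDerivWithinAt_id x (Icc (0:ℝ) 1)).const_mul (l * β))
    refine (d2.congr_deriv ?_).congr ?_ ?_
    · simp [n]; ring
    · intro y _; simp [m, g]; ring
    · simp [m, g]; ring
  · intro x hx
    have d1 := (((hz x hx).neg.add (HD_prim k x hx)).const_mul l).add_const (l * β)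
    refine (d1.congr_deriv ?_).congr ?_ ?_
    · simp [k]; left; ring
    · intro y _; simp [n]; ring
    · simp [n]; ring

lemma dens {s sp : C(ℝ, ℝ)} (hs : ∀ x ∈ Icc (0:ℝ) 1, (sp * s) x = 1) {P : L2I →L[ℝ] L2I}
    (hP : IsProj s P) {v : L2I} (hv : P0 v = v) : v ∈ closure (range (Wop s P)) := by
  let K : Submodule ℝ L2I := LinearMap.range (Wop s P).toLinearMap
  have hK : closure (range (Wop s P)) = (K.topologicalClosure : Set L2I) := by
    rw [Submodule.topologicalClosure_coe]
    rfl
  rw [hK, SetLike.mem_coe, ← Submodule.orthogonal_orthogonal_eq_closure, Submodule.mem_orthogonal]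
  intro g hg
  rw [Submodule.mem_orthogonal] at hg
  have h1 : Wop' s P g = 0 := by
    rw [← inner_self_eq_zero (𝕜 := ℝ), ← Wop_adj hP]
    exact hg _ ⟨_, rfl⟩
  rw [Wop'_apply] at h1
  obtain ⟨α, β, hf⟩ := hP.form (mulL s (V' g))
  rw [h1, ← map_smul, ← map_smul, ← map_add, ← map_add] at hf
  have h2 : V' g + α • one + β • idX = 0 := by
    have := congrArg (mulL sp) hf
    rw [mulL_mulL, mulL_one' _ hs, map_zero] at this
    exact this.symm
  have h3 : V (g - β • one) = (⟪one, g⟫ + α) • one := by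
    rw [map_sub, map_smul, V_one]
    rw [V'_apply] at h2
    rw [← sub_eq_zero, ← neg_eq_zero, ← h2]
    module
  have h4 : ⟪one, g⟫ + α = 0 := by
    have e : (⟪one, g⟫ + α) • one = cL ((⟪one, g⟫ + α) • 1) := by rw [map_smul]; rfl
    rw [e, V_apply, cL_eq_iff] at h3
    have := h3 zero_memI
    rw [prim_zero] at this
    simpa using this.symm
  rw [h4, zero_smul] at h3
  have h5 := V_inj _ h3
  rw [sub_eq_zero] at h5
  rw [h5, inner_smul_left, ← hv, inner_P0, mul_zero]

lemma simple_of (Q : L2I → Prop) (hQ : ∀ v v' (k : ℝ), Q v → Q v' → Q (v' - k • v))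
    (h : ∀ v, Q v → ∃ w : C(ℝ, ℝ), v = cL w ∧ (w 0 = 0 → v = 0)) (v v' : L2I) (hv : v ≠ 0)
    (h1 : Q v) (h2 : Q v') : ∃ k : ℝ, v' = k • v := by
  obtain ⟨w, e1, hw⟩ := h v h1
  obtain ⟨w', e2, -⟩ := h v' h2
  have hw0 : w 0 ≠ 0 := fun h => hv (hw h)
  refine ⟨w' 0 / w 0, ?_⟩
  obtain ⟨x, e3, hx⟩ := h _ (hQ v v' (w' 0 / w 0) h1 h2)
  rw [← sub_eq_zero]
  refine hx ?_
  have e4 : cL (w' - (w' 0 / w 0) • w) = cL x := by rw [← e3, map_sub, map_smul, e1, e2]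
  rw [cL_eq_iff] at e4
  rw [← e4 zero_memI]
  simp [hw0]

lemma cL_zero_of {w : C(ℝ, ℝ)} (h : ∀ x ∈ Icc (0:ℝ) 1, w x = 0) : cL w = 0 := by
  rw [← map_zero cL, cL_eq_iff]
  intro x hx
  simpa using h x hx

lemma zero_of_cL {w : C(ℝ, ℝ)} (h : cL w = 0) : ∀ x ∈ Icc (0:ℝ) 1, w x = 0 := by
  rw [← map_zero cL, cL_eq_iff] at h
  intro x hx
  simpa using h hx

end Ops4

theorem stmt_18 (p r : ℝ → ℝ) (c : ℝ)
    (hpc : ContinuousOn p (Icc 0 1)) (hrc : ContinuousOn r (Icc 0 1))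
    (hp : ∀ x ∈ Icc (0:ℝ) 1, 0 < p x) (hr : ∀ x ∈ Icc (0:ℝ) 1, 0 < r x) :
    ({lam : ℝ | lam < 0 ∧ EigT1 p r c lam}).Finite ∧
    ({lam : ℝ | lam < 0 ∧ ∃ u : ℝ → ℝ, ContDiffOn ℝ 2 u (Icc 0 1) ∧
        (∀ x ∈ Icc (0:ℝ) 1, -(Dv (Dv u) x) + c * r x * u x = lam * u x) ∧
        Nontriv u ∧ u 0 = 0 ∧ u 1 = 0}).Finite ∧
    ({lam : ℝ | lam < 0 ∧ EigT1 p r c lam}).ncard =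
      ({lam : ℝ | lam < 0 ∧ ∃ u : ℝ → ℝ, ContDiffOn ℝ 2 u (Icc 0 1) ∧
        (∀ x ∈ Icc (0:ℝ) 1, -(Dv (Dv u) x) + c * r x * u x = lam * u x) ∧
        Nontriv u ∧ u 0 = 0 ∧ u 1 = 0}).ncard := by
  obtain ⟨R, hR⟩ := exists_ext hrc
  have hsp : ContinuousOn (fun x => √(p x)) (Icc 0 1) := hpc.sqrt
  obtain ⟨sp, hsp'⟩ := exists_ext hsp
  obtain ⟨s, hs'⟩ := exists_ext (hsp.inv₀ (fun x hx => (Real.sqrt_pos.2 (hp x hx)).ne'))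
  have hss : ∀ x ∈ Icc (0:ℝ) 1, (sp * s) x = 1 := by
    intro x hx
    rw [ContinuousMap.mul_apply, hsp' hx, hs' hx]
    exact mul_inv_cancel₀ (Real.sqrt_pos.2 (hp x hx)).ne'
  have hi : ∀ x ∈ Icc (0:ℝ) 1, (s * s) x * p x = 1 := by
    intro x hx
    rw [ContinuousMap.mul_apply, hs' hx]
    simp only [Pi.inv_apply]
    rw [← mul_inv, Real.mul_self_sqrt (hp x hx).le, inv_mul_cancel₀ (hp x hx).ne']
  have hip : ∀ x ∈ Icc (0:ℝ) 1, 0 < (s * s) x := by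
    intro x hx
    have := hi x hx
    by_contra hc
    nlinarith [hp x hx]
  have hRp : ∀ x ∈ Icc (0:ℝ) 1, 0 < R x := fun x hx => by rw [hR hx]; exact hr x hx
  obtain ⟨P, hP⟩ := exists_isProj s
  have nz2 : ∀ {l : ℝ} {U w : C(ℝ, ℝ)}, Sys2 R c l U w → ((∀ x ∈ Icc (0:ℝ) 1, U x = 0) ↔ cL w = 0) := by
    intro l U w h
    constructor
    · intro h0
      exact cL_zero_of (h.hU.zero h0)
    · intro h0
      refine zero_of_cL ?_
      have := V_cL_of_HD h.hU
      rw [h0, h.U0] at this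
      simpa using this.symm
  have nz4 : ∀ {l : ℝ} {Y z m n : C(ℝ, ℝ)}, Sys4 (s * s) R c l Y z m n →
      ((∀ x ∈ Icc (0:ℝ) 1, Y x = 0) ↔ cL (s * m) = 0) := by
    intro l Y z m n h
    constructor
    · intro h0
      have := h.hz.zero (h.hY.zero h0)
      refine cL_zero_of fun x hx => ?_
      have h2 := (mul_eq_zero.1 (this x hx)).resolve_left (hip x hx).ne'
      simp [h2]
    · intro h0
      refine zero_of_cL ?_
      have hz : HD z (s * (s * m) : C(ℝ, ℝ)) := by
        rw [← mul_assoc]; exact h.hz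
      have h1 := V_cL_of_HD hz
      rw [← mulL_cL, h0, h.z0] at h1
      have h2 := V_cL_of_HD h.hY
      have h3 : cL z = 0 := by simpa using h1.symm
      rw [h3, h.Y0] at h2
      simpa using h2.symm
  have hRs : ∀ x y, ⟪mulL (c • R) x, y⟫ = ⟪x, mulL (c • R) y⟫ := mulL_symm _
  refine abs_main (H := L2I) (Aop R c) Jop Jop' (mulL (c • R)) (Wop s P) (Wop' s P) Jop_adj ?_ (Wop_adj hP) ?_
    hRs (Aop_apply R c) (‖mulL (c • R)‖ + 1) (by positivity) ?_ _ _ (fun l hl => hl.1) (fun l hl => hl.1)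
    ?_ ?_ ?_ ?_ ?_ ?_
  · exact V_compact.comp_clm P0
  · exact V_compact.comp_clm (mulL s ∘L P)
  · intro x
    have h1 := abs_real_inner_le_norm (mulL (c • R) x) x
    have h2 := (mulL (c • R)).le_opNorm x
    have h3 := neg_abs_le ⟪mulL (c • R) x, x⟫
    nlinarith [norm_nonneg x]
  · rintro l ⟨hl, h⟩
    rw [N2_iff r c l R hR] at h
    obtain ⟨U, w, h, hne⟩ := h
    obtain ⟨h1, h2⟩ := h.op
    exact ⟨cL w, fun h0 => hne ((nz2 h).2 h0), dens hss hP h1, h2⟩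
  · intro l hl v hv h
    refine ⟨hl, ?_⟩
    rw [N2_iff r c l R hR]
    obtain ⟨U, w, h, e⟩ := Sys2.of_op h
    exact ⟨U, w, h, fun h0 => hv (by rw [e]; exact (nz2 h).1 h0)⟩
  · intro l hl v v' hv h h'
    refine simple_of (fun v => Aop R c v = l • Jop' (Jop v)) ?_ ?_ v v' hv h h'
    · intro v v' k h1 h2
      simp only [map_sub, map_smul] at *
      rw [h1, h2]
      module
    · intro v h
      obtain ⟨U, w, h, e⟩ := Sys2.of_op h
      exact ⟨w, e, fun h0 => by rw [e]; exact cL_zero_of (h.unique h0)⟩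
  · rintro l ⟨hl, h⟩
    rw [N4_iff p r c l (s * s) R hR hi] at h
    obtain ⟨Y, z, m, n, h, hne⟩ := h
    exact ⟨cL (s * m), fun h0 => hne ((nz4 h).2 h0), h.op hP⟩
  · intro l hl v hv h
    refine ⟨hl, ?_⟩
    rw [N4_iff p r c l (s * s) R hR hi]
    obtain ⟨Y, z, m, n, h, e⟩ := Sys4.of_op hP h
    exact ⟨Y, z, m, n, h, fun h0 => hv (by rw [e]; exact (nz4 h).1 h0)⟩
  · intro l hl v v' hv h h'
    rcases le_or_gt 0 c with hc | hc
    · exfalso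
      have hA : 0 ≤ ⟪Aop R c (Wop s P v), Wop s P v⟫ := by
        rw [Aop_apply, inner_add_left, real_inner_comm _ (Jop' _), ← Jop_adj]
        refine add_nonneg ?_ ?_
        · exact real_inner_self_nonneg
        · rw [real_inner_comm]
          refine mulL_nonneg _ (fun x hx => ?_) _
          simpa using mul_nonneg hc (hRp x hx).le
      have h1 : ⟪v, v⟫ = l * ⟪Aop R c (Wop s P v), Wop s P v⟫ := by
        nth_rewrite 1 [← h]
        rw [inner_smul_left, real_inner_comm, ← Wop_adj hP, real_inner_comm]
        simp
      have h2 : 0 < ⟪v, v⟫ := real_inner_self_pos.2 hv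
      nlinarith
    · refine simple_of (fun v => l • Wop' s P (Aop R c (Wop s P v)) = v) ?_ ?_ v v' hv h h'
      · intro v v' k h1 h2
        simp only [map_sub, map_smul, smul_sub] at *
        rw [h2, smul_comm, h1]
      · intro v h
        obtain ⟨Y, z, m, n, h, e⟩ := Sys4.of_op hP h
        refine ⟨s * m, e, fun h0 => ?_⟩
        rw [e]
        have hm0 : m 0 = 0 := by
          have hs0 : s 0 ≠ 0 := by
            intro h3
            have := hip 0 zero_memI
            simp [h3] at this
          exact (mul_eq_zero.1 h0).resolve_left hs0
        refine cL_zero_of fun x hx => ?_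
        simp [h.unique hip hRp hc hl hm0 x hx]
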